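/- arXiv:1611.05998 — 2 statements merged into one kernel-verified Lean document; each statement's English description precedes it below -/
import Mathlib

section
/- There exist constants c > 0 and C > 0 such that for all sufficiently large n there exists a homogeneous polynomial f of degree 4 in n real variables, all of whose coefficients are nonnegative, satisfying ‖f‖₂ ≤ (log n)^C and Λ(f) ≥ c · n^{1/6} / (log n)^2 (i.e., every matrix representation M of f satisfies sup_{‖z‖₂=1} zᵀMz ≥ c · n^{1/6} / (log n)^2). -/
open MvPolynomial

/-- `‖f‖₂ = sup_{‖x‖₂ = 1} |f(x)|` for a polynomial `f` in `n` real variables. -/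
noncomputable def sphereNorm {n : ℕ} (f : MvPolynomial (Fin n) ℝ) : ℝ :=
  sSup {y | ∃ x : Fin n → ℝ, (∑ i, x i ^ 2) = 1 ∧ y = |eval x f|}

/-- `M` is a (symmetric) matrix representation of the polynomial `h`, where rows and
columns are indexed by tuples `I ∈ [n]^k` (with `2k` the degree of `h`). -/
def IsMatrixRepr {n : ℕ} (k : ℕ) (M : Matrix (Fin k → Fin n) (Fin k → Fin n) ℝ)
    (h : MvPolynomial (Fin n) ℝ) : Prop :=
  M.IsSymm ∧ ∀ x : Fin n → ℝ,
    (∑ I : Fin k → Fin n, ∑ J : Fin k → Fin n,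
      M I J * (∏ t, x (I t)) * (∏ t, x (J t))) = eval x h

/-- `sup_{‖z‖₂=1} zᵀ M z`, the maximum eigenvalue of the symmetric matrix `M`. -/
noncomputable def maxEig {n k : ℕ} (M : Matrix (Fin k → Fin n) (Fin k → Fin n) ℝ) : ℝ :=
  sSup {y | ∃ z : (Fin k → Fin n) → ℝ, (∑ I, z I ^ 2) = 1 ∧
    y = ∑ I, ∑ J, z I * M I J * z J}

/-- `Λ(h)`: the infimum over matrix representations `M` of `h` of the maximum
eigenvalue of `M`; `k` is half the degree of `h`. -/
noncomputable def Lam {n : ℕ} (k : ℕ) (h : MvPolynomial (Fin n) ℝ) : ℝ :=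
  sInf {y | ∃ M : Matrix (Fin k → Fin n) (Fin k → Fin n) ℝ, IsMatrixRepr k M h ∧ y = maxEig M}


section Helpers

open Finset

set_option linter.unusedSectionVars false

section Comb
variable {G : Type} [AddCommGroup G] [Fintype G] [DecidableEq G]

/-- The quadruple relation: a parallelogram all of whose differences lie in `D`. -/
def Quad (D : Finset G) (a b c d : G) : Prop :=
  a + b + c + d = 0 ∧ a + b ∈ D ∧ a + c ∈ D ∧ a + d ∈ D

instance (D : Finset G) (a b c d : G) : Decidable (Quad D a b c d) := by
  unfold Quad; infer_instance

/-- Any three distinct vertices have at most eight common neighbours. -/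
def FewCommon (D : Finset G) : Prop :=
  ∀ u v : G, u ≠ 0 → v ≠ 0 → u ≠ v → #{d ∈ D | d + u ∈ D ∧ d + v ∈ D} ≤ 8

lemma Quad.swap12 (D : Finset G) (hG : ∀ a : G, a + a = 0) {a b c d : G} :
    Quad D a b c d → Quad D b a c d := by
  rintro ⟨h, h1, h2, h3⟩
  refine ⟨by rw [← h]; abel, by rwa [add_comm], ?_, ?_⟩
  · have : b + c = a + d := by
      have e : (b + c) + (a + d) = 0 := by rw [← h]; abel
      have := hG (a + d)
      exact add_right_cancel (e.trans this.symm)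
    rwa [this]
  · have : b + d = a + c := by
      have e : (b + d) + (a + c) = 0 := by rw [← h]; abel
      have := hG (a + c)
      exact add_right_cancel (e.trans this.symm)
    rwa [this]

lemma Quad.swap23 (D : Finset G) {a b c d : G} :
    Quad D a b c d → Quad D a c b d := by
  rintro ⟨h, h1, h2, h3⟩
  exact ⟨by rw [← h]; abel, h2, h1, h3⟩

lemma Quad.swap34 (D : Finset G) {a b c d : G} :
    Quad D a b c d → Quad D a b d c := by
  rintro ⟨h, h1, h2, h3⟩
  exact ⟨by rw [← h]; abel, h1, h3, h2⟩

lemma add_eq_zero_two (hG : ∀ a : G, a + a = 0) {a b : G} : a + b = 0 ↔ a = b := by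
  constructor
  · intro h; exact add_right_cancel (h.trans (hG b).symm)
  · rintro rfl; exact hG _

lemma common_le (D : Finset G) (hG : ∀ a : G, a + a = 0) (hD : FewCommon D) (S : Finset G)
    {b b' b'' : G} (h1 : b ≠ b') (h2 : b ≠ b'') (h3 : b' ≠ b'') :
    #{a ∈ S | a + b ∈ D ∧ a + b' ∈ D ∧ a + b'' ∈ D} ≤ 8 := by
  refine le_trans ?_ (hD (b + b') (b + b'') ?_ ?_ ?_)
  · refine Finset.card_le_card_of_injOn (fun a => a + b) ?_ ?_
    · intro a ha
      simp only [coe_filter, Set.mem_ofPred_eq] at ha ⊢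
      refine ⟨ha.2.1, ?_, ?_⟩
      · have : a + b + (b + b') = a + b' + (b + b) := by abel
        rw [this, hG, add_zero]; exact ha.2.2.1
      · have : a + b + (b + b'') = a + b'' + (b + b) := by abel
        rw [this, hG, add_zero]; exact ha.2.2.2
    · intro x _ y _ h
      exact add_right_cancel h
  · intro h; exact h1 ((add_eq_zero_two hG).1 h)
  · intro h; exact h2 ((add_eq_zero_two hG).1 h)
  · intro h; exact h3 (add_left_cancel h)

/-- Neighbours of `a` inside `S`. -/
def nb (D S : Finset G) (a : G) : Finset G := {b ∈ S | a + b ∈ D}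

lemma cube_le (D S : Finset G) (a : G) :
    #(nb D S a) ^ 3 ≤ 2 * (∑ b ∈ S, ∑ b' ∈ S, ∑ b'' ∈ S,
      if (b ≠ b' ∧ b ≠ b'' ∧ b' ≠ b'') ∧ (a + b ∈ D ∧ a + b' ∈ D ∧ a + b'' ∈ D) then 1 else 0)
      + 216 := by
  set t := (∑ b ∈ S, ∑ b' ∈ S, ∑ b'' ∈ S,
      if (b ≠ b' ∧ b ≠ b'' ∧ b' ≠ b'') ∧ (a + b ∈ D ∧ a + b' ∈ D ∧ a + b'' ∈ D) then 1 else 0)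
    with ht
  have ht2 : t = ∑ b ∈ nb D S a, ∑ b' ∈ nb D S a, ∑ b'' ∈ nb D S a,
      if (b ≠ b' ∧ b ≠ b'' ∧ b' ≠ b'') then 1 else 0 := by
    rw [ht]
    unfold nb
    simp only [Finset.sum_filter]
    refine Finset.sum_congr rfl fun b _ => ?_
    by_cases h : a + b ∈ D
    · simp only [h, true_and, if_true]
      refine Finset.sum_congr rfl fun b' _ => ?_
      by_cases h' : a + b' ∈ D
      · simp only [h', true_and, if_true]
        refine Finset.sum_congr rfl fun b'' _ => ?_
        by_cases h'' : a + b'' ∈ D <;> simp [h'']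
      · simp [h']
    · simp [h]
  set N := nb D S a
  set d := #N
  have key : d ^ 3 ≤ t + 3 * d ^ 2 := by
    have e1 : d ^ 3 = ∑ b ∈ N, ∑ b' ∈ N, ∑ b'' ∈ N, 1 := by simp [d]; ring
    have e2 : ∑ b ∈ N, ∑ b' ∈ N, ∑ b'' ∈ N, (if b = b' then 1 else 0) = d ^ 2 := by
      simp [d]; ring
    have e3 : ∑ b ∈ N, ∑ b' ∈ N, ∑ b'' ∈ N, (if b = b'' then 1 else 0) = d ^ 2 := by
      rw [Finset.sum_congr rfl (g := fun _ => #N)]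
      · simp [d]; ring
      · intro x hx; simp [hx]
    have e4 : ∑ b ∈ N, ∑ b' ∈ N, ∑ b'' ∈ N, (if b' = b'' then 1 else 0) = d ^ 2 := by
      rw [Finset.sum_congr rfl (g := fun _ => #N)]
      · simp [d]; ring
      · intro x hx; simp
    rw [e1, ht2, show 3 * d ^ 2 = d ^ 2 + d ^ 2 + d ^ 2 by ring]
    nth_rewrite 1 [← e2]
    nth_rewrite 1 [← e3]
    rw [← e4]
    simp only [← Finset.sum_add_distrib]
    refine Finset.sum_le_sum fun b _ => Finset.sum_le_sum fun b' _ =>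
      Finset.sum_le_sum fun b'' _ => ?_
    split_ifs <;> simp_all
  by_cases h6 : 6 ≤ d
  · nlinarith [Nat.mul_le_mul_right (d^2) h6]
  · have : d ^ 3 ≤ 6 ^ 3 := Nat.pow_le_pow_left (by omega) 3
    omega

lemma sum_cube_le (D : Finset G) (hG : ∀ a : G, a + a = 0) (hD : FewCommon D)
    (S1 S2 : Finset G) (h : #S1 ≤ #S2) :
    ∑ a ∈ S1, #(nb D S2 a) ^ 3 ≤ 232 * #S2 ^ 3 := by
  have h1 : ∑ a ∈ S1, #(nb D S2 a) ^ 3 ≤ ∑ a ∈ S1, (2 * (∑ b ∈ S2, ∑ b' ∈ S2, ∑ b'' ∈ S2,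
      if (b ≠ b' ∧ b ≠ b'' ∧ b' ≠ b'') ∧ (a + b ∈ D ∧ a + b' ∈ D ∧ a + b'' ∈ D) then 1 else 0)
      + 216) := Finset.sum_le_sum fun a _ => cube_le D S2 a
  have h2 : ∑ a ∈ S1, ∑ b ∈ S2, ∑ b' ∈ S2, ∑ b'' ∈ S2,
      (if (b ≠ b' ∧ b ≠ b'' ∧ b' ≠ b'') ∧ (a + b ∈ D ∧ a + b' ∈ D ∧ a + b'' ∈ D) then 1 else 0)
      ≤ 8 * #S2 ^ 3 := by
    rw [Finset.sum_comm]
    calc _ ≤ ∑ b ∈ S2, ∑ b' ∈ S2, ∑ b'' ∈ S2, 8 := by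
          refine Finset.sum_le_sum fun b _ => ?_
          rw [Finset.sum_comm]
          refine Finset.sum_le_sum fun b' _ => ?_
          rw [Finset.sum_comm]
          refine Finset.sum_le_sum fun b'' _ => ?_
          by_cases hb : (b ≠ b' ∧ b ≠ b'' ∧ b' ≠ b'')
          · rw [← Finset.card_filter]
            refine le_trans (Finset.card_le_card ?_) (common_le D hG hD S1 hb.1 hb.2.1 hb.2.2)
            intro a ha
            rw [Finset.mem_filter] at ha ⊢
            exact ⟨ha.1, ha.2.2⟩
          · exact (Finset.sum_eq_zero fun a _ => if_neg fun h => hb h.1).le.trans (Nat.zero_le _)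
      _ = 8 * #S2 ^ 3 := by simp; ring
  rw [Finset.sum_add_distrib, ← Finset.mul_sum] at h1
  simp only [sum_const, smul_eq_mul] at h1
  have h3 : #S2 ≤ #S2 ^ 3 := Nat.le_self_pow (by norm_num) _
  linarith

/-- edges in the link of `a` -/
def linkE (D S2 S3 : Finset G) (a : G) : ℕ :=
  ∑ c ∈ nb D S3 a, ∑ b ∈ nb D S2 a, if b + c ∈ D then 1 else 0

lemma linkE_sq (D : Finset G) (hG : ∀ a : G, a + a = 0) (h0 : (0 : G) ∉ D) (hD : FewCommon D)
    (S2 S3 : Finset G) (a : G) :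
    linkE D S2 S3 a ^ 2 ≤ #(nb D S3 a) * (8 * #(nb D S2 a) ^ 2 + linkE D S2 S3 a) := by
  unfold linkE
  refine le_trans sq_sum_le_card_mul_sum_sq ?_
  refine Nat.mul_le_mul_left _ ?_
  set N2 := nb D S2 a with hN2
  set N3 := nb D S3 a with hN3
  simp only [sq, Finset.sum_mul_sum]
  calc ∑ c ∈ N3, ∑ b ∈ N2, ∑ b' ∈ N2,
        (if b + c ∈ D then 1 else 0) * (if b' + c ∈ D then 1 else 0)
      ≤ ∑ c ∈ N3, ∑ b ∈ N2, ∑ b' ∈ N2,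
        ((if b ≠ b' ∧ b + c ∈ D ∧ b' + c ∈ D then 1 else 0)
          + (if b = b' then (if b + c ∈ D then 1 else 0) else 0)) := by
        refine Finset.sum_le_sum fun b _ => Finset.sum_le_sum fun b' _ =>
          Finset.sum_le_sum fun b'' _ => ?_
        split_ifs <;> simp_all
    _ = (∑ c ∈ N3, ∑ b ∈ N2, ∑ b' ∈ N2,
        (if b ≠ b' ∧ b + c ∈ D ∧ b' + c ∈ D then 1 else 0))
        + ∑ c ∈ N3, ∑ b ∈ N2, if b + c ∈ D then 1 else 0 := by
        simp only [Finset.sum_add_distrib]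
        congr 1
        refine Finset.sum_congr rfl fun c _ => Finset.sum_congr rfl fun b hb => ?_
        simp [hb]
    _ ≤ _ := by
        gcongr
        rw [Finset.sum_comm]
        calc _ ≤ ∑ b ∈ N2, ∑ b' ∈ N2, 8 := by
              refine Finset.sum_le_sum fun b hb => ?_
              rw [Finset.sum_comm]
              refine Finset.sum_le_sum fun b' hb' => ?_
              by_cases hbb : b = b'
              · simp [hbb]
              · rw [← Finset.card_filter]
                rw [hN2, nb, Finset.mem_filter] at hb hb'
                have ha1 : a ≠ b := by rintro rfl; exact h0 (hG a ▸ hb.2)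
                have ha2 : a ≠ b' := by rintro rfl; exact h0 (hG a ▸ hb'.2)
                refine le_trans (Finset.card_le_card ?_)
                    (common_le D hG hD S3 (b := a) (b' := b) (b'' := b') ha1 ha2 hbb)
                intro c hc
                rw [Finset.mem_filter, hN3, nb, Finset.mem_filter] at hc
                rw [Finset.mem_filter]
                refine ⟨hc.1.1, by rw [add_comm]; exact hc.1.2, by rw [add_comm]; exact hc.2.2.1,
                    by rw [add_comm]; exact hc.2.2.2⟩
          _ = _ := by simp; ring


lemma young_aux (u v t : ℝ) (hu : 0 ≤ u) (hv : 0 ≤ v) (ht : 0 < t) :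
    u * √v ≤ t * (u ^ 3 / 3 + v ^ 3 / 6 + 1 / (2 * t ^ 2)) := by
  have h1 : t * (u ^ 3 / 3 + v ^ 3 / 6 + 1 / (2 * t ^ 2))
      = t * (u ^ 3 / 3 + v ^ 3 / 6) + 1 / (2 * t) := by field_simp
  rw [h1]
  have hx : 0 ≤ u ^ 3 / 3 + v ^ 3 / 6 := by positivity
  set x := u ^ 3 / 3 + v ^ 3 / 6 with hxd
  have h2 : (u * √v) ^ 2 ≤ 2 * x := by
    rw [mul_pow, Real.sq_sqrt hv, hxd]
    nlinarith [mul_nonneg (sq_nonneg (u - v)) (by positivity : 0 ≤ 2 * u + v)]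
  have h3 : 2 * x ≤ (t * x + 1 / (2 * t)) ^ 2 := by
    have : (t * x + 1 / (2 * t)) ^ 2 - 2 * x = (t * x - 1 / (2 * t)) ^ 2 := by field_simp; ring
    nlinarith [sq_nonneg (t * x - 1 / (2 * t))]
  exact le_of_sq_le_sq (h2.trans h3) (by positivity)

/-- Number of quadruples in a box. -/
def cnt (D S1 S2 S3 S4 : Finset G) : ℕ :=
  ∑ a ∈ S1, ∑ b ∈ S2, ∑ c ∈ S3, ∑ d ∈ S4, if Quad D a b c d then 1 else 0

lemma cnt_le_link (D : Finset G) (hG : ∀ a : G, a + a = 0) (S1 S2 S3 S4 : Finset G) :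
    cnt D S1 S2 S3 S4 ≤ ∑ a ∈ S1, linkE D S2 S3 a := by
  unfold cnt linkE
  refine Finset.sum_le_sum fun a _ => ?_
  rw [Finset.sum_comm]
  unfold nb
  rw [Finset.sum_filter]
  refine Finset.sum_le_sum fun c _ => ?_
  by_cases hc : a + c ∈ D
  · rw [if_pos hc, Finset.sum_filter]
    refine Finset.sum_le_sum fun b _ => ?_
    by_cases hb : a + b ∈ D
    · rw [if_pos hb]
      by_cases hbc : b + c ∈ D
      · rw [if_pos hbc]
        rw [← Finset.card_filter, Finset.card_le_one]
        intro d hd d' hd'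
        simp only [Finset.mem_filter] at hd hd'
        exact add_left_cancel (hd.2.1.trans hd'.2.1.symm)
      · rw [if_neg hbc]
        refine le_of_eq (Finset.sum_eq_zero fun d _ => if_neg ?_)
        intro h
        have := (Quad.swap12 D hG h).2.2.1
        exact hbc this
    · rw [if_neg hb]
      refine le_of_eq (Finset.sum_eq_zero fun d _ => if_neg ?_)
      intro h; exact hb h.2.1
  · rw [if_neg hc]
    refine le_of_eq (Finset.sum_eq_zero fun d _ => Finset.sum_eq_zero fun d _ => if_neg ?_)
    intro h; exact hc h.2.2.1

lemma cnt_sorted (D : Finset G) (hG : ∀ a : G, a + a = 0) (h0 : (0 : G) ∉ D) (hD : FewCommon D)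
    (S1 S2 S3 S4 : Finset G) (h12 : #S1 ≤ #S2) (h23 : #S2 ≤ #S3) (h34 : #S3 ≤ #S4) :
    (cnt D S1 S2 S3 S4 : ℝ) ≤ 361 * (√(#S1) * √(#S2) * √(#S3) * √(#S4)) := by
  rcases Nat.eq_zero_or_pos (#S1) with hz | hpos
  · have : S1 = ∅ := Finset.card_eq_zero.1 hz
    simp [cnt, this]
  have hA : ∀ a ∈ S1, (linkE D S2 S3 a : ℝ) ≤
      #(nb D S3 a) + 3 * (#(nb D S2 a) * √(#(nb D S3 a))) := by
    intro a _
    have h := linkE_sq D hG h0 hD S2 S3 a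
    have h' : (linkE D S2 S3 a : ℝ) ^ 2 ≤
        #(nb D S3 a) * (8 * (#(nb D S2 a) : ℝ) ^ 2 + linkE D S2 S3 a) := by exact_mod_cast h
    set e : ℝ := (linkE D S2 S3 a : ℝ)
    set y : ℝ := ((#(nb D S2 a) : ℕ) : ℝ)
    have hs := Real.sq_sqrt (Nat.cast_nonneg (α := ℝ) #(nb D S3 a))
    have hr0 := Real.sqrt_nonneg (#(nb D S3 a) : ℝ)
    set r := √(#(nb D S3 a) : ℝ)
    rw [← hs] at h' ⊢
    have hy : 0 ≤ y := Nat.cast_nonneg _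
    by_contra hcon
    push Not at hcon
    nlinarith [mul_nonneg hy hr0, mul_nonneg (mul_nonneg hy hr0) (sq_nonneg r), sq_nonneg (y * r)]
  have p1 : (0 : ℝ) < #S1 := by exact_mod_cast hpos
  have p2 : (0 : ℝ) < #S2 := by exact_mod_cast lt_of_lt_of_le hpos h12
  have p3 : (0 : ℝ) < #S3 := by exact_mod_cast lt_of_lt_of_le hpos (h12.trans h23)
  have c2 : ∑ a ∈ S1, (#(nb D S2 a) / #S2 : ℝ) ^ 3 ≤ 232 := by
    have h := sum_cube_le D hG hD S1 S2 h12
    have h' : ∑ a ∈ S1, (#(nb D S2 a) : ℝ) ^ 3 ≤ 232 * (#S2 : ℝ) ^ 3 := by exact_mod_cast h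
    simp only [div_pow]
    rw [← Finset.sum_div, div_le_iff₀ (by positivity)]
    exact h'
  have c3 : ∑ a ∈ S1, (#(nb D S3 a) / #S3 : ℝ) ^ 3 ≤ 232 := by
    have h := sum_cube_le D hG hD S1 S3 (h12.trans h23)
    have h' : ∑ a ∈ S1, (#(nb D S3 a) : ℝ) ^ 3 ≤ 232 * (#S3 : ℝ) ^ 3 := by exact_mod_cast h
    simp only [div_pow]
    rw [← Finset.sum_div, div_le_iff₀ (by positivity)]
    exact h'
  have hH : ∑ a ∈ S1, (#(nb D S2 a) * √(#(nb D S3 a)) : ℝ) ≤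
      #S2 * √(#S3) * √(#S1) * 117 := by
    have hterm : ∀ a ∈ S1, (#(nb D S2 a) * √(#(nb D S3 a)) : ℝ) ≤
        #S2 * √(#S3) * √(#S1) * ((#(nb D S2 a) / #S2 : ℝ) ^ 3 / 3 +
          (#(nb D S3 a) / #S3 : ℝ) ^ 3 / 6 + 1 / (2 * #S1)) := by
      intro a _
      have hy := young_aux (#(nb D S2 a) / #S2 : ℝ) (#(nb D S3 a) / #S3 : ℝ) (√(#S1))
        (by positivity) (by positivity) (by positivity)
      rw [Real.sq_sqrt p1.le] at hy
      have := mul_le_mul_of_nonneg_left hy (by positivity : (0:ℝ) ≤ #S2 * √(#S3))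
      rw [Real.sqrt_div (Nat.cast_nonneg _)] at this
      have p3' : 0 < √(#S3 : ℝ) := Real.sqrt_pos.2 p3
      have e : (#S2 * √(#S3) : ℝ) * (#(nb D S2 a) / #S2 * (√(#(nb D S3 a)) / √(#S3))) =
        #(nb D S2 a) * √(#(nb D S3 a)) := by field_simp
      rw [e] at this
      linarith
    refine (Finset.sum_le_sum hterm).trans ?_
    rw [← Finset.mul_sum]
    refine mul_le_mul_of_nonneg_left ?_ (by positivity)
    rw [Finset.sum_add_distrib, Finset.sum_add_distrib, ← Finset.sum_div, ← Finset.sum_div]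
    have : ∑ a ∈ S1, (1 / (2 * #S1) : ℝ) = 1 / 2 := by
      rw [Finset.sum_const, nsmul_eq_mul]; field_simp
    rw [this]
    linarith
  have hS3 : ∑ a ∈ S1, (#(nb D S3 a) : ℝ) ≤ #S1 * #S3 := by
    refine (Finset.sum_le_card_nsmul _ _ (#S3 : ℝ) ?_).trans (by simp)
    intro a _
    exact_mod_cast Finset.card_le_card (Finset.filter_subset _ _)
  have htot : (cnt D S1 S2 S3 S4 : ℝ) ≤ #S1 * #S3 + 3 * (#S2 * √(#S3) * √(#S1) * 117) := by
    have h1 : (cnt D S1 S2 S3 S4 : ℝ) ≤ ∑ a ∈ S1, (linkE D S2 S3 a : ℝ) := by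
      exact_mod_cast cnt_le_link D hG S1 S2 S3 S4
    have h2 := Finset.sum_le_sum hA
    rw [Finset.sum_add_distrib, ← Finset.mul_sum] at h2
    linarith
  have q12 : √(#S1 : ℝ) ≤ √(#S2) := Real.sqrt_le_sqrt (by exact_mod_cast h12)
  have q23 : √(#S2 : ℝ) ≤ √(#S3) := Real.sqrt_le_sqrt (by exact_mod_cast h23)
  have q34 : √(#S3 : ℝ) ≤ √(#S4) := Real.sqrt_le_sqrt (by exact_mod_cast h34)
  have e1 := Real.mul_self_sqrt p1.le
  have e2 := Real.mul_self_sqrt p2.le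
  have e3 := Real.mul_self_sqrt p3.le
  set r1 := √(#S1 : ℝ)
  set r2 := √(#S2 : ℝ)
  set r3 := √(#S3 : ℝ)
  set r4 := √(#S4 : ℝ)
  have z1 : 0 ≤ r1 := Real.sqrt_nonneg _
  have z2 : 0 ≤ r2 := Real.sqrt_nonneg _
  have z3 : 0 ≤ r3 := Real.sqrt_nonneg _
  have z4 : 0 ≤ r4 := Real.sqrt_nonneg _
  rw [← e1, ← e2, ← e3] at htot
  have k1 : r1 * r1 * (r3 * r3) ≤ r1 * r2 * r3 * r4 := by
    calc r1 * r1 * (r3 * r3) ≤ r1 * r2 * (r3 * r4) := by gcongr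
      _ = _ := by ring
  have k2 : r2 * r2 * r3 * r1 ≤ r1 * r2 * r3 * r4 := by
    calc r2 * r2 * r3 * r1 ≤ r2 * r4 * r3 * r1 := by gcongr; linarith
      _ = _ := by ring
  linarith

lemma cnt_swap12 (D : Finset G) (hG : ∀ a : G, a + a = 0) (S1 S2 S3 S4 : Finset G) :
    cnt D S1 S2 S3 S4 = cnt D S2 S1 S3 S4 := by
  unfold cnt
  rw [Finset.sum_comm]
  refine Finset.sum_congr rfl fun a _ => Finset.sum_congr rfl fun b _ =>
    Finset.sum_congr rfl fun c _ => Finset.sum_congr rfl fun d _ => ?_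
  exact if_congr ⟨Quad.swap12 D hG, Quad.swap12 D hG⟩ rfl rfl

lemma cnt_swap23 (D : Finset G) (S1 S2 S3 S4 : Finset G) :
    cnt D S1 S2 S3 S4 = cnt D S1 S3 S2 S4 := by
  unfold cnt
  refine Finset.sum_congr rfl fun a _ => ?_
  rw [Finset.sum_comm]
  refine Finset.sum_congr rfl fun b _ =>
    Finset.sum_congr rfl fun c _ => Finset.sum_congr rfl fun d _ => ?_
  exact if_congr ⟨Quad.swap23 D, Quad.swap23 D⟩ rfl rfl

lemma cnt_swap34 (D : Finset G) (S1 S2 S3 S4 : Finset G) :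
    cnt D S1 S2 S3 S4 = cnt D S1 S2 S4 S3 := by
  unfold cnt
  refine Finset.sum_congr rfl fun a _ => Finset.sum_congr rfl fun b _ => ?_
  rw [Finset.sum_comm]
  refine Finset.sum_congr rfl fun c _ => Finset.sum_congr rfl fun d _ => ?_
  exact if_congr ⟨Quad.swap34 D, Quad.swap34 D⟩ rfl rfl

lemma cnt_le (D : Finset G) (hG : ∀ a : G, a + a = 0) (h0 : (0 : G) ∉ D) (hD : FewCommon D)
    (S1 S2 S3 S4 : Finset G) :
    (cnt D S1 S2 S3 S4 : ℝ) ≤ 361 * (√(#S1) * √(#S2) * √(#S3) * √(#S4)) := by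
  -- insertion sort, one element at a time
  have st4 : ∀ S1 S2 S3 S4 : Finset G, #S1 ≤ #S2 → #S2 ≤ #S3 →
      (cnt D S1 S2 S3 S4 : ℝ) ≤ 361 * (√(#S1) * √(#S2) * √(#S3) * √(#S4)) := by
    intro S1 S2 S3 S4 h12 h23
    rcases le_total (#S3) (#S4) with h | h
    · exact cnt_sorted D hG h0 hD _ _ _ _ h12 h23 h
    rw [cnt_swap34]
    rcases le_total (#S2) (#S4) with h' | h'
    · exact (cnt_sorted D hG h0 hD _ _ _ _ h12 h' h).trans (le_of_eq (by ring))
    rw [cnt_swap23]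
    rcases le_total (#S1) (#S4) with h'' | h''
    · exact (cnt_sorted D hG h0 hD _ _ _ _ h'' h' h23).trans (le_of_eq (by ring))
    rw [cnt_swap12 D hG]
    exact (cnt_sorted D hG h0 hD _ _ _ _ h'' h12 h23).trans (le_of_eq (by ring))
  have st3 : ∀ S1 S2 S3 S4 : Finset G, #S1 ≤ #S2 →
      (cnt D S1 S2 S3 S4 : ℝ) ≤ 361 * (√(#S1) * √(#S2) * √(#S3) * √(#S4)) := by
    intro S1 S2 S3 S4 h12
    rcases le_total (#S2) (#S3) with h | h
    · exact st4 _ _ _ _ h12 h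
    rw [cnt_swap23]
    rcases le_total (#S1) (#S3) with h' | h'
    · exact (st4 _ _ _ _ h' h).trans (le_of_eq (by ring))
    rw [cnt_swap12 D hG]
    exact (st4 _ _ _ _ h' h12).trans (le_of_eq (by ring))
  rcases le_total (#S1) (#S2) with h | h
  · exact st3 _ _ _ _ h
  rw [cnt_swap12 D hG]
  exact (st3 _ _ _ _ h).trans (le_of_eq (by ring))

/-- The quartic form. -/
noncomputable def quartic (D : Finset G) (x : G → ℝ) : ℝ :=
  ∑ a, ∑ b, ∑ c, ∑ d, if Quad D a b c d then x a * x b * x c * x d else 0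

lemma level_aux (x : ℝ) (hx : x ≤ 1) (J : ℕ) :
    x ≤ (1 / 2) ^ J ∨ ∃ j < J, (1 / 2) ^ (j + 1) < x ∧ x ≤ (1 / 2) ^ j := by
  induction J with
  | zero => left; simpa using hx
  | succ J ih =>
    rcases ih with h | ⟨j, hj, h⟩
    · by_cases h' : x ≤ (1 / 2) ^ (J + 1)
      · left; exact h'
      · right; exact ⟨J, by omega, not_le.1 h', h⟩
    · right; exact ⟨j, by omega, h⟩

lemma slot_aux (s : Finset ℕ) (S : ℕ → Finset G) (c : ℕ → ℝ) (w : G → ℝ) :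
    ∑ a, (∑ j ∈ s, if a ∈ S j then c j else 0) * w a = ∑ j ∈ s, c j * ∑ a ∈ S j, w a := by
  simp only [Finset.sum_mul]
  rw [Finset.sum_comm]
  refine Finset.sum_congr rfl fun j _ => ?_
  rw [Finset.mul_sum, ← Finset.sum_filter_add_sum_filter_not _ (fun a => a ∈ S j)]
  rw [Finset.sum_eq_zero (s := Finset.univ.filter (fun a => a ∉ S j)), add_zero]
  · rw [Finset.filter_mem_eq_inter, Finset.univ_inter]
    exact Finset.sum_congr rfl fun a ha => by rw [if_pos ha]
  · intro a ha
    rw [if_neg (Finset.mem_filter.1 ha).2, zero_mul]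

lemma pull_aux (s : Finset ℕ) (T : Finset G) (c : ℕ → ℝ) (v : ℕ → G → ℝ) :
    ∑ a ∈ T, ∑ j ∈ s, c j * v j a = ∑ j ∈ s, c j * ∑ a ∈ T, v j a := by
  rw [Finset.sum_comm]
  simp only [Finset.mul_sum]

lemma quartic_expand (D : Finset G) (s : Finset ℕ) (S : ℕ → Finset G) (c : ℕ → ℝ) :
    quartic D (fun a => ∑ j ∈ s, if a ∈ S j then c j else 0)
      = ∑ i ∈ s, ∑ j ∈ s, ∑ k ∈ s, ∑ l ∈ s,
        c i * c j * c k * c l * (cnt D (S i) (S j) (S k) (S l) : ℝ) := by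
  have h1 : ∀ x : G → ℝ, quartic D x = ∑ a, x a * ∑ b, x b * ∑ e, x e * ∑ d, x d *
      (if Quad D a b e d then 1 else 0) := by
    intro x
    unfold quartic
    simp only [Finset.mul_sum]
    refine Finset.sum_congr rfl fun a _ => Finset.sum_congr rfl fun b _ =>
      Finset.sum_congr rfl fun e _ => Finset.sum_congr rfl fun d _ => ?_
    split_ifs <;> ring
  rw [h1]
  simp only [slot_aux]
  have h2 : ∀ i j k, ∑ a ∈ S i, ∑ b ∈ S j, ∑ e ∈ S k, ∑ l ∈ s, c l * ∑ d ∈ S l,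
      (if Quad D a b e d then (1 : ℝ) else 0) = ∑ l ∈ s, c l * (cnt D (S i) (S j) (S k) (S l) : ℝ) := by
    intro i j k
    simp only [pull_aux]
    refine Finset.sum_congr rfl fun l _ => ?_
    simp [cnt]
  have h3 : ∀ i j, ∑ a ∈ S i, ∑ b ∈ S j, ∑ k ∈ s, c k * ∑ e ∈ S k, ∑ l ∈ s, c l * ∑ d ∈ S l,
      (if Quad D a b e d then (1 : ℝ) else 0)
        = ∑ k ∈ s, c k * ∑ l ∈ s, c l * (cnt D (S i) (S j) (S k) (S l) : ℝ) := by
    intro i j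
    rw [Finset.sum_congr rfl fun a _ => pull_aux s (S j) c _, pull_aux]
    exact Finset.sum_congr rfl fun k _ => by rw [h2]
  have h4 : ∀ i, ∑ a ∈ S i, ∑ j ∈ s, c j * ∑ b ∈ S j, ∑ k ∈ s, c k * ∑ e ∈ S k, ∑ l ∈ s,
      c l * ∑ d ∈ S l, (if Quad D a b e d then (1 : ℝ) else 0)
        = ∑ j ∈ s, c j * ∑ k ∈ s, c k * ∑ l ∈ s, c l * (cnt D (S i) (S j) (S k) (S l) : ℝ) := by
    intro i
    rw [pull_aux]
    exact Finset.sum_congr rfl fun k _ => by rw [h3]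
  rw [Finset.sum_congr rfl fun i _ => by rw [h4 i]]
  simp only [Finset.mul_sum]
  refine Finset.sum_congr rfl fun a _ => Finset.sum_congr rfl fun b _ =>
      Finset.sum_congr rfl fun e _ => Finset.sum_congr rfl fun d _ => ?_
  ring

lemma sum_cnt_le (D : Finset G) (hG : ∀ a : G, a + a = 0) (h0 : (0 : G) ∉ D) (hD : FewCommon D)
    (J : ℕ) (S : ℕ → Finset G) (c : ℕ → ℝ) (hc0 : ∀ j, 0 ≤ c j)
    (hcS : ∀ j, c j * √(#(S j)) ≤ 2) :
    ∑ i ∈ Finset.range (J + 1), ∑ j ∈ Finset.range (J + 1),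
      ∑ k ∈ Finset.range (J + 1), ∑ l ∈ Finset.range (J + 1),
        c i * c j * c k * c l * (cnt D (S i) (S j) (S k) (S l) : ℝ)
      ≤ 5776 * ((J : ℝ) + 1) ^ 4 := by
  calc _ ≤ ∑ i ∈ Finset.range (J + 1), ∑ j ∈ Finset.range (J + 1),
      ∑ k ∈ Finset.range (J + 1), ∑ l ∈ Finset.range (J + 1), (5776 : ℝ) := by
        refine Finset.sum_le_sum fun i _ => Finset.sum_le_sum fun j _ =>
          Finset.sum_le_sum fun k _ => Finset.sum_le_sum fun l _ => ?_
        have h1 := cnt_le D hG h0 hD (S i) (S j) (S k) (S l)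
        have hi := hcS i; have hj := hcS j; have hk := hcS k; have hl := hcS l
        have n1 := mul_nonneg (hc0 i) (Real.sqrt_nonneg (#(S i) : ℝ))
        have n2 := mul_nonneg (hc0 j) (Real.sqrt_nonneg (#(S j) : ℝ))
        have n3 := mul_nonneg (hc0 k) (Real.sqrt_nonneg (#(S k) : ℝ))
        have n4 := mul_nonneg (hc0 l) (Real.sqrt_nonneg (#(S l) : ℝ))
        have n0 : 0 ≤ c i * c j * c k * c l :=
          mul_nonneg (mul_nonneg (mul_nonneg (hc0 i) (hc0 j)) (hc0 k)) (hc0 l)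
        calc _ ≤ c i * c j * c k * c l *
              (361 * (√(#(S i)) * √(#(S j)) * √(#(S k)) * √(#(S l)))) :=
              mul_le_mul_of_nonneg_left h1 n0
          _ = 361 * ((c i * √(#(S i))) * (c j * √(#(S j))) * (c k * √(#(S k)))
              * (c l * √(#(S l)))) := by ring
          _ ≤ 361 * (2 * 2 * 2 * 2) := by gcongr
          _ = 5776 := by norm_num
    _ = _ := by simp; ring

lemma quartic_le (D : Finset G) (hG : ∀ a : G, a + a = 0) (h0 : (0 : G) ∉ D) (hD : FewCommon D)
    (x : G → ℝ) (hx0 : ∀ a, 0 ≤ x a) (hx : ∑ a, x a ^ 2 ≤ 1) (J : ℕ)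
    (hJ : Fintype.card G ≤ 4 ^ J) :
    quartic D x ≤ 5776 * ((J : ℝ) + 1) ^ 4 := by
  classical
  let S : ℕ → Finset G := fun j =>
    if j = J then Finset.univ else Finset.univ.filter (fun a => (1 / 2 : ℝ) ^ (j + 1) < x a)
  let c : ℕ → ℝ := fun j => (1 / 2) ^ j
  have hc0 : ∀ j, 0 ≤ c j := fun j => by positivity
  have hx1 : ∀ a, x a ≤ 1 := by
    intro a
    have : x a ^ 2 ≤ 1 := (Finset.single_le_sum (f := fun a => x a ^ 2)
      (fun i _ => sq_nonneg _) (Finset.mem_univ a)).trans hx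
    nlinarith [hx0 a]
  have hcS : ∀ j, c j * √(#(S j)) ≤ 2 := by
    intro j
    have hle : (#(S j) : ℝ) ≤ 4 * 4 ^ j := by
      by_cases hj : j = J
      · simp only [S, hj, if_true, Finset.card_univ]
        have : (Fintype.card G : ℝ) ≤ 4 ^ J := by exact_mod_cast hJ
        have h4 : (0:ℝ) < 4 ^ J := by positivity
        linarith
      · have h1 : ∑ a ∈ S j, ((1 / 2 : ℝ) ^ (j + 1)) ^ 2 ≤ 1 := by
          refine le_trans ?_ hx
          refine le_trans (Finset.sum_le_sum (g := fun a => x a ^ 2) ?_)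
            (Finset.sum_le_sum_of_subset_of_nonneg (Finset.subset_univ _)
              (fun _ _ _ => sq_nonneg _))
          intro a ha
          simp only [S, hj, if_false, Finset.mem_filter] at ha
          exact pow_le_pow_left₀ (by positivity) ha.2.le 2
        rw [Finset.sum_const, nsmul_eq_mul] at h1
        have e : ((1 / 2 : ℝ) ^ (j + 1)) ^ 2 = 1 / (4 * 4 ^ j) := by
          rw [← pow_mul, mul_comm, pow_mul, pow_succ]; norm_num [mul_comm, ← inv_pow]
        rw [e, mul_one_div, div_le_one (by positivity)] at h1
        exact h1
    have h2 : √(#(S j) : ℝ) ≤ 2 * 2 ^ j := by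
      rw [Real.sqrt_le_left (by positivity)]
      refine hle.trans (le_of_eq ?_)
      rw [mul_pow, ← pow_mul, mul_comm j 2, pow_mul]; norm_num
    calc c j * √(#(S j)) ≤ (1 / 2) ^ j * (2 * 2 ^ j) := by
          exact mul_le_mul_of_nonneg_left h2 (hc0 j)
      _ = 2 * ((1 / 2) * 2) ^ j := by rw [mul_pow]; ring
      _ = 2 := by norm_num
  let y : G → ℝ := fun a => ∑ j ∈ Finset.range (J + 1), if a ∈ S j then c j else 0
  have hxy : ∀ a, x a ≤ y a := by
    intro a
    have hnn : ∀ i ∈ Finset.range (J + 1), 0 ≤ if a ∈ S i then c i else 0 := by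
      intro i _; split_ifs; exact hc0 i; exact le_rfl
    rcases level_aux (x a) (hx1 a) J with h | ⟨j, hj, h1, h2⟩
    · refine le_trans ?_ (Finset.single_le_sum hnn (Finset.mem_range.2 (Nat.lt_succ_self J)))
      simpa [S, c] using h
    · refine le_trans ?_ (Finset.single_le_sum hnn (Finset.mem_range.2 (by omega : j < J + 1)))
      have : a ∈ S j := by simp only [S, hj.ne, if_false]; simpa using h1
      rw [if_pos this]
      exact h2
  have hy0 : ∀ a, 0 ≤ y a := fun a => (hx0 a).trans (hxy a)
  have hle : quartic D x ≤ quartic D y := by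
    unfold quartic
    refine Finset.sum_le_sum fun a _ => Finset.sum_le_sum fun b _ =>
      Finset.sum_le_sum fun c _ => Finset.sum_le_sum fun d _ => ?_
    split_ifs
    · have := hx0 a; have := hx0 b; have := hx0 c; have := hx0 d
      have := hy0 a; have := hy0 b; have := hy0 c
      have := hxy a; have := hxy b; have := hxy c; have := hxy d
      gcongr
    · exact le_rfl
  have hexp := quartic_expand D (Finset.range (J + 1)) S c
  rw [hexp] at hle
  exact hle.trans (sum_cnt_le D hG h0 hD J S c hc0 hcS)

end Comb
set_option linter.unusedSectionVars false
section Sym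
variable {α : Type} [DecidableEq α]

lemma sym2_fac (F : α → α → ℝ) (h12 : ∀ a b, F a b = F b a) {a b a' b' : α}
    (h : ({a, b} : Multiset α) = {a', b'}) : F a b = F a' b' := by
  have ha : a' ∈ ({a, b} : Multiset α) := by rw [h]; simp
  simp only [Multiset.insert_eq_cons, Multiset.mem_cons, Multiset.mem_singleton] at ha
  rcases ha with rfl | rfl
  · have h' : ({b} : Multiset α) = {b'} := (Multiset.cons_inj_right a').1 h
    rw [Multiset.singleton_inj.1 h']
  · rw [h12]
    have h' : ({a} : Multiset α) = {b'} := by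
      refine (Multiset.cons_inj_right a').1 ?_
      rw [← Multiset.insert_eq_cons, ← Multiset.insert_eq_cons, ← h]
      exact Multiset.pair_comm _ _
    rw [Multiset.singleton_inj.1 h']

lemma sym3_fac (F : α → α → α → ℝ) (h12 : ∀ a b c, F a b c = F b a c)
    (h23 : ∀ a b c, F a b c = F a c b) {a b c a' b' c' : α}
    (h : (a ::ₘ b ::ₘ {c} : Multiset α) = a' ::ₘ b' ::ₘ {c'}) : F a b c = F a' b' c' := by
  have ha : a' ∈ (a ::ₘ b ::ₘ {c} : Multiset α) := by rw [h]; simp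
  simp only [Multiset.mem_cons, Multiset.mem_singleton] at ha
  have key : ∀ b c, (a' ::ₘ b ::ₘ {c} : Multiset α) = a' ::ₘ b' ::ₘ {c'} →
      F a' b c = F a' b' c' := fun b c hh =>
    sym2_fac (F a') (h23 a') ((Multiset.cons_inj_right a').1 hh)
  rcases ha with rfl | rfl | rfl
  · exact key _ _ h
  · rw [h12]; exact key _ _ (by rw [← h, Multiset.cons_swap])
  · rw [h23, h12]
    refine key _ _ (by rw [← h, Multiset.cons_swap]; congr 1; exact Multiset.pair_comm _ _)

lemma sym4_fac (F : α → α → α → α → ℝ) (h12 : ∀ a b c d, F a b c d = F b a c d)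
    (h23 : ∀ a b c d, F a b c d = F a c b d) (h34 : ∀ a b c d, F a b c d = F a b d c)
    {a b c d a' b' c' d' : α}
    (h : (a ::ₘ b ::ₘ c ::ₘ {d} : Multiset α) = a' ::ₘ b' ::ₘ c' ::ₘ {d'}) :
    F a b c d = F a' b' c' d' := by
  have ha : a' ∈ (a ::ₘ b ::ₘ c ::ₘ {d} : Multiset α) := by rw [h]; simp
  simp only [Multiset.mem_cons, Multiset.mem_singleton] at ha
  have key : ∀ b c d, (a' ::ₘ b ::ₘ c ::ₘ {d} : Multiset α) = a' ::ₘ b' ::ₘ c' ::ₘ {d'} →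
      F a' b c d = F a' b' c' d' := fun b c d hh =>
    sym3_fac (F a') (h23 a') (h34 a') ((Multiset.cons_inj_right a').1 hh)
  rcases ha with rfl | rfl | rfl | rfl
  · exact key _ _ _ h
  · rw [h12]; exact key _ _ _ (by rw [← h, Multiset.cons_swap])
  · rw [h23, h12]
    exact key _ _ _ (by rw [← h, Multiset.cons_swap, Multiset.cons_swap b])
  · rw [h34, h23, h12]
    refine key _ _ _ ?_
    rw [← h, Multiset.cons_swap]
    congr 1
    rw [Multiset.cons_swap]
    congr 1
    exact Multiset.pair_comm _ _

variable [Fintype α]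

/-- the polynomial with coefficient array `M`. -/
noncomputable def polyOf (M : α → α → α → α → ℝ) : MvPolynomial α ℝ :=
  ∑ a, ∑ b, ∑ c, ∑ d, M a b c d • (MvPolynomial.X a * MvPolynomial.X b *
    MvPolynomial.X c * MvPolynomial.X d)

lemma eval_polyOf (M : α → α → α → α → ℝ) (x : α → ℝ) :
    MvPolynomial.eval x (polyOf M) = ∑ a, ∑ b, ∑ c, ∑ d, M a b c d * (x a * x b * x c * x d) := by
  simp [polyOf, MvPolynomial.smul_eval]

lemma polyOf_pair (T : α → α → α → α → ℝ) (h12 : ∀ a b c d, T a b c d = T b a c d)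
    (h23 : ∀ a b c d, T a b c d = T a c b d) (h34 : ∀ a b c d, T a b c d = T a b d c)
    (M N : α → α → α → α → ℝ)
    (h : ∀ x : α → ℝ, ∑ a, ∑ b, ∑ c, ∑ d, M a b c d * (x a * x b * x c * x d)
      = ∑ a, ∑ b, ∑ c, ∑ d, N a b c d * (x a * x b * x c * x d)) :
    ∑ a, ∑ b, ∑ c, ∑ d, M a b c d * T a b c d = ∑ a, ∑ b, ∑ c, ∑ d, N a b c d * T a b c d := by
  have hp : polyOf M = polyOf N := by
    apply MvPolynomial.funext
    intro x
    rw [eval_polyOf, eval_polyOf, h]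
  let mo : α × α × α × α → (α →₀ ℕ) := fun p =>
    Finsupp.single p.1 1 + Finsupp.single p.2.1 1 + Finsupp.single p.2.2.1 1
      + Finsupp.single p.2.2.2 1
  let T' : α × α × α × α → ℝ := fun p => T p.1 p.2.1 p.2.2.1 p.2.2.2
  have hfac : Function.FactorsThrough T' mo := by
    intro p p' hpp
    have := congrArg Finsupp.toMultiset hpp
    simp only [mo, map_add, Finsupp.toMultiset_single, one_smul] at this
    refine sym4_fac T h12 h23 h34 ?_
    simpa [← Multiset.singleton_add, add_assoc] using this
  let φ : (α →₀ ℕ) → ℝ := Function.extend mo T' 0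
  let L : MvPolynomial α ℝ →ₗ[ℝ] ℝ := (MvPolynomial.basisMonomials α ℝ).constr ℝ φ
  have hL : ∀ a b c d, L (MvPolynomial.X a * MvPolynomial.X b *
      MvPolynomial.X c * MvPolynomial.X d) = T a b c d := by
    intro a b c d
    have e : (MvPolynomial.X a * MvPolynomial.X b * MvPolynomial.X c * MvPolynomial.X d :
        MvPolynomial α ℝ) = MvPolynomial.basisMonomials α ℝ (mo (a, b, c, d)) := by
      simp [mo, MvPolynomial.X, MvPolynomial.monomial_mul]
    rw [e]
    simp only [L]
    rw [Module.Basis.constr_basis]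
    exact hfac.extend_apply 0 (a, b, c, d)
  have := congrArg L hp
  simpa [polyOf, map_sum, hL] using this

end Sym

/-- trace inequality against a positive semidefinite form -/
lemma trace_ineq {I : Type} [Fintype I] [DecidableEq I] (T M : Matrix I I ℝ) (hT : T.PosSemidef)
    (Λ : ℝ) (hM : ∀ z : I → ℝ, ∑ i, ∑ j, z i * M i j * z j ≤ Λ * ∑ i, z i ^ 2) :
    ∑ i, ∑ j, M i j * T i j ≤ Λ * ∑ i, T i i := by
  open scoped MatrixOrder in
  obtain ⟨B, rfl⟩ : ∃ B : Matrix I I ℝ, T = B.conjTranspose * B :=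
    CStarAlgebra.nonneg_iff_eq_star_mul_self.1 (Matrix.nonneg_iff_posSemidef.2 hT)
  have e : ∀ i j, (B.conjTranspose * B) i j = ∑ k, B k i * B k j := by
    intro i j; simp [Matrix.mul_apply]
  simp only [e]
  calc ∑ i, ∑ j, M i j * ∑ k, B k i * B k j = ∑ k, ∑ i, ∑ j, B k i * M i j * B k j := by
        simp only [Finset.mul_sum]
        rw [Finset.sum_congr rfl fun i _ => Finset.sum_comm, Finset.sum_comm]
        refine Finset.sum_congr rfl fun k _ => Finset.sum_congr rfl fun i _ =>
          Finset.sum_congr rfl fun j _ => by ring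
    _ ≤ ∑ k, Λ * ∑ i, B k i ^ 2 := Finset.sum_le_sum fun k _ => hM _
    _ = _ := by
        rw [← Finset.mul_sum, Finset.sum_comm]
        simp only [sq]

section Dual
variable {G : Type} [AddCommGroup G] [Fintype G] [DecidableEq G]

/-- indicator -/
def ind (p : Prop) [Decidable p] : ℝ := if p then 1 else 0

lemma ind_nonneg (p : Prop) [Decidable p] : 0 ≤ ind p := by unfold ind; split_ifs <;> norm_num

/-- the dual certificate -/
noncomputable def dualT (D : Finset G) (l : ℝ) (a b c d : G) : ℝ :=
  ind (Quad D a b c d) + l * (ind (a = b ∧ c = d ∧ a + c ∈ D) + ind (a = c ∧ b = d ∧ a + b ∈ D)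
    + ind (a = d ∧ b = c ∧ a + b ∈ D)) + l * #D * ind (a = b ∧ a = c ∧ a = d)

lemma ind_congr {p r : Prop} [Decidable p] [Decidable r] (h : p ↔ r) : ind p = ind r := by
  unfold ind; exact if_congr h rfl rfl

lemma dualT_12 (D : Finset G) (hG : ∀ a : G, a + a = 0) (l : ℝ) (a b c d : G) :
    dualT D l a b c d = dualT D l b a c d := by
  unfold dualT
  rw [ind_congr (p := Quad D a b c d) ⟨Quad.swap12 D hG, Quad.swap12 D hG⟩,
    ind_congr (p := a = b ∧ c = d ∧ a + c ∈ D) (r := b = a ∧ c = d ∧ b + c ∈ D) (by aesop),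
    ind_congr (p := a = c ∧ b = d ∧ a + b ∈ D) (r := b = d ∧ a = c ∧ b + a ∈ D)
      (by rw [add_comm]; tauto),
    ind_congr (p := a = d ∧ b = c ∧ a + b ∈ D) (r := b = c ∧ a = d ∧ b + a ∈ D)
      (by rw [add_comm]; tauto),
    ind_congr (p := a = b ∧ a = c ∧ a = d) (r := b = a ∧ b = c ∧ b = d) (by aesop)]
  ring

lemma dualT_23 (D : Finset G) (l : ℝ) (a b c d : G) :
    dualT D l a b c d = dualT D l a c b d := by
  unfold dualT
  rw [ind_congr (p := Quad D a b c d) ⟨Quad.swap23 D, Quad.swap23 D⟩,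
    ind_congr (p := a = d ∧ b = c ∧ a + b ∈ D) (r := a = d ∧ c = b ∧ a + c ∈ D) (by aesop),
    ind_congr (p := a = b ∧ a = c ∧ a = d) (r := a = c ∧ a = b ∧ a = d) (by tauto)]
  ring

lemma dualT_34 (D : Finset G) (l : ℝ) (a b c d : G) :
    dualT D l a b c d = dualT D l a b d c := by
  unfold dualT
  rw [ind_congr (p := Quad D a b c d) ⟨Quad.swap34 D, Quad.swap34 D⟩,
    ind_congr (p := a = b ∧ c = d ∧ a + c ∈ D) (r := a = b ∧ d = c ∧ a + d ∈ D) (by aesop),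
    ind_congr (p := a = b ∧ a = c ∧ a = d) (r := a = b ∧ a = d ∧ a = c) (by tauto)]
  ring

lemma shift_sum (a : G) (F : G → ℝ) : ∑ b, F b = ∑ b, F (a + b) :=
  (Fintype.sum_equiv (Equiv.addLeft a) (fun b => F (a + b)) F (fun _ => rfl)).symm

lemma quad_shift (D : Finset G) (hG : ∀ a : G, a + a = 0) (a b c d : G) :
    Quad D a (a + b) (a + c) (a + d) ↔ d = b + c ∧ b ∈ D ∧ c ∈ D ∧ d ∈ D := by
  have e : ∀ x, a + (a + x) = x := fun x => by rw [← add_assoc, hG, zero_add]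
  unfold Quad
  have e2 : a + (a + b) + (a + c) + (a + d) = (b + c) + d := by
    rw [e]; have := e (b + c + d)
    calc b + (a + c) + (a + d) = a + (a + (b + c + d)) := by abel
      _ = _ := this
  rw [e2, e, e, e, add_eq_zero_two hG, eq_comm]

lemma quad_sum (D : Finset G) (hG : ∀ a : G, a + a = 0) (H : G → G → G → G → ℝ) :
    ∑ a, ∑ b, ∑ c, ∑ d, ind (Quad D a b c d) * H a b c d
      = ∑ δ ∈ D, ∑ ε ∈ D with ε + δ ∈ D, ∑ a, H a (a + δ) (a + ε) (a + (δ + ε)) := by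
  have h1 : ∀ a, ∑ b, ∑ c, ∑ d, ind (Quad D a b c d) * H a b c d
      = ∑ δ ∈ D, ∑ ε ∈ D with ε + δ ∈ D, H a (a + δ) (a + ε) (a + (δ + ε)) := by
    intro a
    rw [shift_sum a, ← Finset.sum_subset (Finset.subset_univ D)]
    · refine Finset.sum_congr rfl fun δ hδ => ?_
      rw [shift_sum a, ← Finset.sum_subset (Finset.subset_univ (D.filter (fun ε => ε + δ ∈ D)))]
      · refine Finset.sum_congr rfl fun ε hε => ?_
        rw [shift_sum a, Finset.sum_eq_single (δ + ε)]
        · rw [ind, if_pos, one_mul]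
          rw [Finset.mem_filter] at hε
          exact (quad_shift D hG _ _ _ _).2 ⟨rfl, hδ, hε.1, by rw [add_comm]; exact hε.2⟩
        · intro d _ hd
          rw [ind, if_neg, zero_mul]
          rw [quad_shift D hG]; tauto
        · simp
      · intro ε _ hε
        rw [shift_sum a]
        refine Finset.sum_eq_zero fun d _ => ?_
        rw [ind, if_neg, zero_mul]
        rw [quad_shift D hG]
        rintro ⟨rfl, h1, h2, h3⟩
        exact hε (Finset.mem_filter.2 ⟨h2, by rwa [add_comm]⟩)
    · intro δ _ hδ
      rw [shift_sum a]
      refine Finset.sum_eq_zero fun c _ => ?_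
      rw [shift_sum a]
      refine Finset.sum_eq_zero fun d _ => ?_
      rw [ind, if_neg, zero_mul]
      rw [quad_shift D hG]; tauto
  simp only [h1]
  rw [Finset.sum_comm]
  exact Finset.sum_congr rfl fun δ _ => by rw [Finset.sum_comm]

/-- spectral hypothesis -/
def Spec (D : Finset G) (l : ℝ) : Prop := ∀ δ ∈ D, ∀ g : G → ℝ,
  -(l * ∑ a, g a ^ 2) ≤ ∑ ε ∈ D with ε + δ ∈ D, ∑ a, g a * g (a + ε)

lemma dual_psd_symm (D : Finset G) (hG : ∀ a : G, a + a = 0) (l : ℝ) (hl : 0 ≤ l)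
    (hS : Spec D l) (z : G → G → ℝ) (hz : ∀ a b, z a b = z b a) :
    0 ≤ ∑ a, ∑ b, ∑ c, ∑ d, dualT D l a b c d * (z a b * z c d) := by
  have hsplit : ∑ a, ∑ b, ∑ c, ∑ d, dualT D l a b c d * (z a b * z c d)
      = (∑ a, ∑ b, ∑ c, ∑ d, ind (Quad D a b c d) * (z a b * z c d))
      + l * ((∑ a, ∑ b, ∑ c, ∑ d, ind (a = b ∧ c = d ∧ a + c ∈ D) * (z a b * z c d))
      + (∑ a, ∑ b, ∑ c, ∑ d, ind (a = c ∧ b = d ∧ a + b ∈ D) * (z a b * z c d))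
      + (∑ a, ∑ b, ∑ c, ∑ d, ind (a = d ∧ b = c ∧ a + b ∈ D) * (z a b * z c d)))
      + l * #D * (∑ a, ∑ b, ∑ c, ∑ d, ind (a = b ∧ a = c ∧ a = d) * (z a b * z c d)) := by
    simp only [Finset.mul_sum, ← Finset.sum_add_distrib]
    refine Finset.sum_congr rfl fun a _ => Finset.sum_congr rfl fun b _ =>
      Finset.sum_congr rfl fun c _ => Finset.sum_congr rfl fun d _ => ?_
    unfold dualT
    ring
  have hd4 : ∑ a, ∑ b, ∑ c, ∑ d, ind (a = b ∧ a = c ∧ a = d) * (z a b * z c d)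
      = ∑ a, z a a ^ 2 := by
    refine Finset.sum_congr rfl fun a _ => ?_
    simp [ind, ite_and, sq]
  have hd1 : ∑ a, ∑ b, ∑ c, ∑ d, ind (a = b ∧ c = d ∧ a + c ∈ D) * (z a b * z c d)
      = ∑ a, ∑ c, ind (a + c ∈ D) * (z a a * z c c) := by
    refine Finset.sum_congr rfl fun a _ => ?_
    simp [ind, ite_and]
  have hd2 : ∑ a, ∑ b, ∑ c, ∑ d, ind (a = c ∧ b = d ∧ a + b ∈ D) * (z a b * z c d)
      = ∑ a, ∑ b, ind (a + b ∈ D) * z a b ^ 2 := by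
    refine Finset.sum_congr rfl fun a _ => ?_
    refine Finset.sum_congr rfl fun b _ => ?_
    simp [ind, ite_and, sq]
  have hd3 : ∑ a, ∑ b, ∑ c, ∑ d, ind (a = d ∧ b = c ∧ a + b ∈ D) * (z a b * z c d)
      = ∑ a, ∑ b, ind (a + b ∈ D) * z a b ^ 2 := by
    refine Finset.sum_congr rfl fun a _ => ?_
    refine Finset.sum_congr rfl fun b _ => ?_
    simp [ind, ite_and, sq, hz b a]
  have hcount : ∀ a : G, ∑ c, ind (a + c ∈ D) = #D := by
    intro a
    rw [shift_sum a]
    have e : ∀ x, a + (a + x) = x := fun x => by rw [← add_assoc, hG, zero_add]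
    simp [e, ind]
  have hb1 : -(#D * ∑ a, z a a ^ 2) ≤ ∑ a, ∑ c, ind (a + c ∈ D) * (z a a * z c c) := by
    have s1 : ∑ a, ∑ c, ind (a + c ∈ D) * (z a a ^ 2) = #D * ∑ a, z a a ^ 2 := by
      simp only [← Finset.sum_mul, hcount, Finset.mul_sum]
    have s2 : ∑ a, ∑ c, ind (a + c ∈ D) * (z c c ^ 2) = #D * ∑ a, z a a ^ 2 := by
      rw [Finset.sum_comm, ← s1]
      refine Finset.sum_congr rfl fun a _ => Finset.sum_congr rfl fun c _ => ?_
      rw [add_comm]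
    have s3 : 0 ≤ ∑ a, ∑ c, ind (a + c ∈ D) * (z a a + z c c) ^ 2 :=
      Finset.sum_nonneg fun a _ => Finset.sum_nonneg fun c _ =>
        mul_nonneg (ind_nonneg _) (sq_nonneg _)
    have s4 : ∑ a, ∑ c, ind (a + c ∈ D) * (z a a + z c c) ^ 2
        = ∑ a, ∑ c, ind (a + c ∈ D) * (z a a ^ 2) + ∑ a, ∑ c, ind (a + c ∈ D) * (z c c ^ 2)
        + 2 * ∑ a, ∑ c, ind (a + c ∈ D) * (z a a * z c c) := by
      simp only [Finset.mul_sum, ← Finset.sum_add_distrib]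
      refine Finset.sum_congr rfl fun a _ => Finset.sum_congr rfl fun c _ => ?_
      ring
    linarith
  have hs2 : ∑ a, ∑ b, ind (a + b ∈ D) * z a b ^ 2 = ∑ δ ∈ D, ∑ a, z a (a + δ) ^ 2 := by
    rw [Finset.sum_comm (s := D)]
    refine Finset.sum_congr rfl fun a _ => ?_
    rw [shift_sum a]
    have e : ∀ x, a + (a + x) = x := fun x => by rw [← add_assoc, hG, zero_add]
    simp only [e, ind, ite_mul, one_mul, zero_mul]
    simp
  have hq : -(l * ∑ δ ∈ D, ∑ a, z a (a + δ) ^ 2)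
      ≤ ∑ a, ∑ b, ∑ c, ∑ d, ind (Quad D a b c d) * (z a b * z c d) := by
    rw [quad_sum D hG, Finset.mul_sum, ← Finset.sum_neg_distrib]
    refine Finset.sum_le_sum fun δ hδ => ?_
    have := hS δ hδ (fun a => z a (a + δ))
    refine this.trans (le_of_eq ?_)
    refine Finset.sum_congr rfl fun ε _ => Finset.sum_congr rfl fun a _ => ?_
    rw [show a + ε + δ = a + (δ + ε) by abel]
  have hs0 : 0 ≤ ∑ δ ∈ D, ∑ a, z a (a + δ) ^ 2 :=
    Finset.sum_nonneg fun a _ => Finset.sum_nonneg fun c _ => sq_nonneg _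
  rw [hsplit, hd1, hd2, hd3, hd4, hs2]
  nlinarith [mul_nonneg hl hs0, mul_le_mul_of_nonneg_left hb1 hl]

lemma dual_psd (D : Finset G) (hG : ∀ a : G, a + a = 0) (l : ℝ) (hl : 0 ≤ l)
    (hS : Spec D l) (z : G → G → ℝ) :
    0 ≤ ∑ a, ∑ b, ∑ c, ∑ d, dualT D l a b c d * (z a b * z c d) := by
  have h := dual_psd_symm D hG l hl hS (fun a b => z a b + z b a) (fun a b => add_comm _ _)
  have e : ∑ a, ∑ b, ∑ c, ∑ d, dualT D l a b c d * ((z a b + z b a) * (z c d + z d c))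
      = (∑ a, ∑ b, ∑ c, ∑ d, dualT D l a b c d * (z a b * z c d))
      + (∑ a, ∑ b, ∑ c, ∑ d, dualT D l a b c d * (z b a * z c d))
      + ((∑ a, ∑ b, ∑ c, ∑ d, dualT D l a b c d * (z a b * z d c))
      + (∑ a, ∑ b, ∑ c, ∑ d, dualT D l a b c d * (z b a * z d c))) := by
    simp only [← Finset.sum_add_distrib]
    refine Finset.sum_congr rfl fun a _ => Finset.sum_congr rfl fun b _ =>
      Finset.sum_congr rfl fun c _ => Finset.sum_congr rfl fun d _ => ?_
    ring
  have sw1 : ∀ w : G → G → ℝ, ∑ a, ∑ b, ∑ c, ∑ d, dualT D l a b c d * (z b a * w c d)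
      = ∑ a, ∑ b, ∑ c, ∑ d, dualT D l a b c d * (z a b * w c d) := by
    intro w
    rw [Finset.sum_comm]
    refine Finset.sum_congr rfl fun a _ => Finset.sum_congr rfl fun b _ =>
      Finset.sum_congr rfl fun c _ => Finset.sum_congr rfl fun d _ => ?_
    rw [dualT_12 D hG]
  have sw2 : ∑ a, ∑ b, ∑ c, ∑ d, dualT D l a b c d * (z a b * z d c)
      = ∑ a, ∑ b, ∑ c, ∑ d, dualT D l a b c d * (z a b * z c d) := by
    refine Finset.sum_congr rfl fun a _ => Finset.sum_congr rfl fun b _ => ?_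
    rw [Finset.sum_comm]
    refine Finset.sum_congr rfl fun c _ => Finset.sum_congr rfl fun d _ => ?_
    rw [dualT_34 D]
  have e2 := sw1 z
  have e3 := sw1 (fun c d => z d c)
  rw [e, e2, e3, sw2] at h
  linarith

lemma dual_bound (D : Finset G) (hG : ∀ a : G, a + a = 0) (h0 : (0 : G) ∉ D) (l : ℝ) (hl : 0 ≤ l)
    (hS : Spec D l) (r : ℝ) (hr : ∀ δ ∈ D, r ≤ (#{ε ∈ D | ε + δ ∈ D} : ℕ))
    (M : Matrix (G × G) (G × G) ℝ)
    (hM : ∀ x : G → ℝ, ∑ i : G × G, ∑ j : G × G, M i j * (x i.1 * x i.2) * (x j.1 * x j.2)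
      = quartic D x)
    (Λ : ℝ) (hΛ : ∀ z : G × G → ℝ, ∑ i, ∑ j, z i * M i j * z j ≤ Λ * ∑ i, z i ^ 2) :
    Fintype.card G * #D * r ≤ Λ * (2 * l * (Fintype.card G * #D)) := by
  let T : Matrix (G × G) (G × G) ℝ := fun i j => dualT D l i.1 i.2 j.1 j.2
  have hsym : ∀ a b c d, dualT D l a b c d = dualT D l c d a b := by
    intro a b c d
    rw [dualT_23, dualT_12 D hG, dualT_34, dualT_23]
  have hT : T.PosSemidef := by
    refine Matrix.PosSemidef.of_dotProduct_mulVec_nonneg ?_ ?_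
    · ext i j
      exact hsym _ _ _ _
    · intro z
      have := dual_psd D hG l hl hS (fun a b => z (a, b))
      refine this.trans (le_of_eq ?_)
      simp only [dotProduct, Matrix.mulVec, Fintype.sum_prod_type, T, Finset.mul_sum, star_trivial]
      refine Finset.sum_congr rfl fun a _ => Finset.sum_congr rfl fun b _ =>
        Finset.sum_congr rfl fun c _ => Finset.sum_congr rfl fun d _ => ?_
      ring
  have hti := trace_ineq T M hT Λ hΛ
  have htr : ∑ i, T i i = 2 * l * (Fintype.card G * #D) := by
    have hcount : ∀ a : G, ∑ c, ind (a + c ∈ D) = #D := by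
      intro a
      rw [shift_sum a]
      have e : ∀ x, a + (a + x) = x := fun x => by rw [← add_assoc, hG, zero_add]
      simp [e, ind]
    have : ∀ a b, T (a, b) (a, b) = l * ind (a + b ∈ D) + l * #D * ind (a = b) := by
      intro a b
      simp only [T, dualT]
      rw [show ind (Quad D a b a b) = 0 from if_neg (fun h => h0 (hG a ▸ h.2.2.1)),
        show ind (a = b ∧ a = b ∧ a + a ∈ D) = 0 from if_neg (fun h => h0 (hG a ▸ h.2.2)),
        show ind (a = b ∧ b = a ∧ a + b ∈ D) = 0 from if_neg (fun h => h0 (by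
          have h2 := h.2.2; rw [h.1, hG] at h2; exact h2))]
      simp
    rw [Fintype.sum_prod_type]
    simp only [this, Finset.sum_add_distrib, ← Finset.mul_sum, hcount]
    simp [ind]
    ring
  have hpair := polyOf_pair (dualT D l) (dualT_12 D hG l) (dualT_23 D l) (dualT_34 D l)
    (fun a b c d => M (a, b) (c, d)) (fun a b c d => ind (Quad D a b c d)) (by
      intro x
      have := hM x
      simp only [Fintype.sum_prod_type] at this
      calc _ = quartic D x := by
            rw [← this]
            refine Finset.sum_congr rfl fun a _ => Finset.sum_congr rfl fun b _ =>
              Finset.sum_congr rfl fun c _ => Finset.sum_congr rfl fun d _ => ?_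
            ring
        _ = _ := by
            unfold quartic
            refine Finset.sum_congr rfl fun a _ => Finset.sum_congr rfl fun b _ =>
              Finset.sum_congr rfl fun c _ => Finset.sum_congr rfl fun d _ => ?_
            simp [ind])
  have hMT : ∑ i, ∑ j, M i j * T i j
      = ∑ a, ∑ b, ∑ c, ∑ d, M (a, b) (c, d) * dualT D l a b c d := by
    simp only [Fintype.sum_prod_type, T]
  rw [hMT, hpair, htr] at hti
  refine le_trans ?_ hti
  rw [quad_sum D hG]
  calc (Fintype.card G * #D * r : ℝ) = ∑ δ ∈ D, Fintype.card G * r := by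
        rw [Finset.sum_const, nsmul_eq_mul]; ring
    _ ≤ ∑ δ ∈ D, ∑ ε ∈ D with ε + δ ∈ D, ∑ a : G, (1 : ℝ) := by
        refine Finset.sum_le_sum fun δ hδ => ?_
        simp only [Finset.sum_const, nsmul_eq_mul, Finset.card_univ, mul_one]
        rw [mul_comm]
        exact mul_le_mul_of_nonneg_right (hr δ hδ) (Nat.cast_nonneg _)
    _ ≤ _ := by
        refine Finset.sum_le_sum fun δ hδ => Finset.sum_le_sum fun ε hε =>
          Finset.sum_le_sum fun a _ => ?_
        rw [Finset.mem_filter] at hε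
        have hq : Quad D a (a + δ) (a + ε) (a + (δ + ε)) :=
          (quad_shift D hG _ _ _ _).2 ⟨rfl, hδ, hε.1, by rw [add_comm]; exact hε.2⟩
        unfold dualT
        have e1 : ind (Quad D a (a + δ) (a + ε) (a + (δ + ε))) = 1 := if_pos hq
        rw [e1]
        have n1 := ind_nonneg (a = a + δ ∧ a + ε = a + (δ + ε) ∧ a + (a + ε) ∈ D)
        have n2 := ind_nonneg (a = a + ε ∧ a + δ = a + (δ + ε) ∧ a + (a + δ) ∈ D)
        have n3 := ind_nonneg (a = a + (δ + ε) ∧ a + δ = a + ε ∧ a + (a + δ) ∈ D)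
        have n4 := ind_nonneg (a = a + δ ∧ a = a + ε ∧ a = a + (δ + ε))
        have m1 := mul_nonneg hl (add_nonneg (add_nonneg n1 n2) n3)
        have m2 := mul_nonneg (mul_nonneg hl (Nat.cast_nonneg (α := ℝ) #D)) n4
        linarith

end Dual

section Alg
variable {F K : Type} [Field F] [Fintype F] [DecidableEq F] [CharP F 2]
  [Field K] [Fintype K] [DecidableEq K] [CharP K 2] [Algebra F K]

lemma coord_indep {η : K} (hη : ∀ a : F, algebraMap F K a ≠ η) {u v : F}
    (h : algebraMap F K u + algebraMap F K v * η = 0) : u = 0 ∧ v = 0 := by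
  have hv : v = 0 := by
    by_contra hv
    have hv' : algebraMap F K v ≠ 0 := by simpa using hv
    apply hη (-u / v)
    rw [map_div₀, map_neg, div_eq_iff hv']
    linear_combination -h
  subst hv
  simp only [map_zero, zero_mul, add_zero] at h
  exact ⟨by simpa using h, rfl⟩

lemma coord_exists (hdim : Module.finrank F K = 2) {η : K} (hη : ∀ a : F, algebraMap F K a ≠ η)
    (w : K) : ∃ a b : F, w = algebraMap F K a + algebraMap F K b * η := by
  have hli : LinearIndependent F ![(1 : K), η] := by
    rw [LinearIndependent.pair_iff]
    intro s t h
    rw [Algebra.smul_def, Algebra.smul_def, mul_one] at h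
    exact coord_indep hη h
  have hsp := hli.span_eq_top_of_card_eq_finrank' (by simp [hdim])
  have hw : w ∈ Submodule.span F (Set.range ![(1 : K), η]) := by rw [hsp]; trivial
  rw [Matrix.range_cons, Matrix.range_cons, Matrix.range_empty, Set.union_empty,
    Set.singleton_union, Submodule.mem_span_pair] at hw
  obtain ⟨a, b, h⟩ := hw
  refine ⟨a, b, ?_⟩
  rw [← h, Algebra.smul_def, Algebra.smul_def, mul_one]

lemma coord_quad (hdim : Module.finrank F K = 2) {η : K} (hη : ∀ a : F, algebraMap F K a ≠ η) :
    ∃ T N : F, T ≠ 0 ∧ N ≠ 0 ∧ η ^ 2 = algebraMap F K T * η + algebraMap F K N := by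
  obtain ⟨N, T, h⟩ := coord_exists hdim hη (η ^ 2)
  refine ⟨T, N, ?_, ?_, by rw [h]; ring⟩
  · rintro rfl
    obtain ⟨m, hm⟩ : ∃ m : F, m ^ 2 = N := by
      obtain ⟨m, hm⟩ := FiniteField.isSquare_of_char_two (ringChar.eq F 2 ▸ rfl) N
      exact ⟨m, by rw [hm]; ring⟩
    apply hη m
    have h3 : (algebraMap F K m - η) ^ 2 = 0 := by
      rw [CharTwo.sub_eq_add, CharTwo.add_sq, h, ← map_pow, hm]
      simp [CharTwo.add_self_eq_zero]
    exact sub_eq_zero.1 (pow_eq_zero_iff (two_ne_zero) |>.1 h3)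
  · rintro rfl
    have h3 : η * (η - algebraMap F K T) = 0 := by
      rw [map_zero, zero_add] at h
      linear_combination h
    rcases mul_eq_zero.1 h3 with h4 | h4
    · exact hη 0 (by simp [h4])
    · exact hη T (sub_eq_zero.1 h4).symm

/-- counting pairs through a polynomial in the second coordinate -/
lemma count_pairs (S : Finset (F × F)) (N : F) (p : Polynomial F) (hp : p ≠ 0) (m : ℕ)
    (hm : p.natDegree ≤ m) (h1 : ∀ x ∈ S, x.1 ^ 2 + x.1 = N * x.2 ^ 2)
    (h2 : ∀ x ∈ S, p.eval x.2 = 0) : #S ≤ 2 * m := by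
  have hc1 : #(S.image Prod.snd) ≤ m := by
    have : S.image Prod.snd ⊆ p.roots.toFinset := by
      intro b hb
      obtain ⟨x, hx, rfl⟩ := Finset.mem_image.1 hb
      rw [Multiset.mem_toFinset, Polynomial.mem_roots hp]
      exact h2 x hx
    exact (Finset.card_le_card this).trans ((Multiset.toFinset_card_le _).trans
      ((Polynomial.card_roots' p).trans hm))
  refine (Finset.card_le_mul_card_image (f := Prod.snd) S 2 ?_).trans
    (Nat.mul_le_mul_left 2 hc1)
  intro b _
  let r : Polynomial F := Polynomial.X ^ 2 + Polynomial.X + Polynomial.C (-(N * b ^ 2))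
  have hrd : r.natDegree = 2 := by simp only [r]; compute_degree!
  have hr : r ≠ 0 := by intro h; rw [h] at hrd; simp at hrd
  have : #(S.filter (fun x => x.2 = b)) ≤ #r.roots.toFinset := by
    refine Finset.card_le_card_of_injOn Prod.fst ?_ ?_
    · intro x hx
      simp only [Finset.coe_filter, Set.mem_ofPred_eq] at hx
      simp only [Finset.mem_coe, Multiset.mem_toFinset]
      rw [Polynomial.mem_roots hr, Polynomial.IsRoot]
      have := h1 x hx.1
      rw [hx.2] at this
      simp only [r, Polynomial.eval_add, Polynomial.eval_pow, Polynomial.eval_X, Polynomial.eval_C]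
      rw [this]; ring
    · intro x hx y hy hxy
      simp only [Finset.coe_filter, Set.mem_ofPred_eq] at hx hy
      exact Prod.ext hxy (hx.2.trans hy.2.symm)
  exact this.trans ((Multiset.toFinset_card_le _).trans ((Polynomial.card_roots' r).trans hrd.le))

/-- the cubic-type function -/
def hfun (tr : K →ₗ[F] F) (θ : K) (X : K) : F := tr (θ * X ^ 3)

/-- its polarization -/
def bfun (tr : K →ₗ[F] F) (θ : K) (X Y : K) : F := tr (θ * (X ^ 2 * Y + X * Y ^ 2))

lemma hfun_add (tr : K →ₗ[F] F) (θ : K) (X Y : K) :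
    hfun tr θ (X + Y) = hfun tr θ X + hfun tr θ Y + bfun tr θ X Y := by
  unfold hfun bfun
  rw [← map_add, ← map_add]
  congr 1
  have h2 : (2 : K) = 0 := CharTwo.two_eq_zero
  linear_combination (θ * (X ^ 2 * Y + X * Y ^ 2)) * h2

lemma bfun_add (tr : K →ₗ[F] F) (θ : K) (X Y Z : K) :
    bfun tr θ X (Y + Z) = bfun tr θ X Y + bfun tr θ X Z := by
  unfold bfun
  rw [← map_add]
  congr 1
  have h2 : (2 : K) = 0 := CharTwo.two_eq_zero
  linear_combination (θ * X * Y * Z) * h2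

lemma bfun_comm (tr : K →ₗ[F] F) (θ : K) (X Y : K) :
    bfun tr θ X Y = bfun tr θ Y X := by
  unfold bfun
  congr 1
  ring

/-- Standing hypotheses for the algebraic construction. -/
structure Good (tr : K →ₗ[F] F) (θ : K) : Prop where
  dim : Module.finrank F K = 2
  ker : ∀ u, tr u = 0 ↔ ∃ a : F, algebraMap F K a = u
  cube : ∀ X : K, X ≠ 0 → ∀ a : F, algebraMap F K a ≠ θ * X ^ 3

variable {tr : K →ₗ[F] F} {θ : K}

lemma Good.theta_ne (hg : Good tr θ) : θ ≠ 0 := by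
  rintro rfl
  exact hg.cube 1 one_ne_zero 0 (by simp)

lemma Good.eta (hg : Good tr θ) {X : K} (hX : X ≠ 0) :
    ∀ a : F, algebraMap F K a ≠ (θ * X ^ 3)⁻¹ := by
  intro a h
  refine hg.cube X hX a⁻¹ ?_
  rw [map_inv₀, h, inv_inv]

/-- `B(X y, X w) = 0` in coordinates. -/
lemma Good.bzero (hg : Good tr θ) {X : K} (hX : X ≠ 0) (T N : F)
    (hq : ((θ * X ^ 3)⁻¹) ^ 2 = algebraMap F K T * (θ * X ^ 3)⁻¹ + algebraMap F K N)
    (c d a b : F) (hB : bfun tr θ (X * (algebraMap F K c + algebraMap F K d * (θ * X ^ 3)⁻¹))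
      (X * (algebraMap F K a + algebraMap F K b * (θ * X ^ 3)⁻¹)) = 0) :
    (c ^ 2 + d ^ 2 * N) * a + d ^ 2 * T * b * N + c * (a ^ 2 + b ^ 2 * N) + d * b ^ 2 * T * N
      = 0 := by
  have hη := hg.eta hX
  have h2 : (2 : K) = 0 := CharTwo.two_eq_zero
  unfold bfun at hB
  rw [hg.ker] at hB
  obtain ⟨t, ht⟩ := hB
  have hne : θ * X ^ 3 ≠ 0 := mul_ne_zero hg.theta_ne (pow_ne_zero 3 hX)
  set η := (θ * X ^ 3)⁻¹ with hηd
  have e1 : (θ * X ^ 3) * η = 1 := mul_inv_cancel₀ hne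
  have ht2 : algebraMap F K t * η = (algebraMap F K c + algebraMap F K d * η) ^ 2 *
      (algebraMap F K a + algebraMap F K b * η) + (algebraMap F K c + algebraMap F K d * η) *
      (algebraMap F K a + algebraMap F K b * η) ^ 2 := by
    rw [ht]
    linear_combination ((algebraMap F K c + algebraMap F K d * η) ^ 2 *
      (algebraMap F K a + algebraMap F K b * η) + (algebraMap F K c + algebraMap F K d * η) *
      (algebraMap F K a + algebraMap F K b * η) ^ 2) * e1
  refine (coord_indep hη (u := _) (v := -t + (c ^ 2 + d ^ 2 * N) * b + d ^ 2 * T * a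
      + d ^ 2 * T * b * T + c * b ^ 2 * T + d * (a ^ 2 + b ^ 2 * N) + d * b ^ 2 * T * T) ?_).1
  simp only [map_add, map_mul, map_pow, map_neg]
  set t' := algebraMap F K t
  set a' := algebraMap F K a
  set b' := algebraMap F K b
  set c' := algebraMap F K c
  set d' := algebraMap F K d
  set T' := algebraMap F K T
  set N' := algebraMap F K N
  have hy2 : (c' + d' * η) ^ 2 = c' ^ 2 + d' ^ 2 * N' + d' ^ 2 * T' * η := by
    linear_combination d' ^ 2 * hq + c' * d' * η * h2
  have hw2 : (a' + b' * η) ^ 2 = a' ^ 2 + b' ^ 2 * N' + b' ^ 2 * T' * η := by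
    linear_combination b' ^ 2 * hq + a' * b' * η * h2
  rw [hy2, hw2] at ht2
  linear_combination -ht2 - (d' ^ 2 * T' * b' + d' * b' ^ 2 * T') * hq

lemma Good.bself (hg : Good tr θ) {X : K} (hX : X ≠ 0) (T N : F)
    (hq : ((θ * X ^ 3)⁻¹) ^ 2 = algebraMap F K T * (θ * X ^ 3)⁻¹ + algebraMap F K N)
    (a b : F) (hB : bfun tr θ X
      (X * (algebraMap F K a + algebraMap F K b * (θ * X ^ 3)⁻¹)) = 0) :
    a ^ 2 + a = N * b ^ 2 := by
  have h2 : (2 : F) = 0 := CharTwo.two_eq_zero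
  have h := hg.bzero hX T N hq 1 0 a b (by simpa using hB)
  linear_combination h - N * b ^ 2 * h2

lemma Good.common (hg : Good tr θ) {U V : K} (hU : U ≠ 0) (hV : V ≠ 0) (hUV : U ≠ V) :
    #{W : K | bfun tr θ U W = 0 ∧ bfun tr θ V W = 0} ≤ 8 := by
  have h2 : (2 : F) = 0 := CharTwo.two_eq_zero
  have hη := hg.eta hU
  obtain ⟨T, N, hT, hN, hq⟩ := coord_quad hg.dim hη
  obtain ⟨c, d, hcd⟩ := coord_exists hg.dim hη (V / U)
  have hVU : V = U * (algebraMap F K c + algebraMap F K d * (θ * U ^ 3)⁻¹) := by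
    rw [← hcd]; field_simp
  have hco : ∀ W : K, ∃ x : F × F,
      W = U * (algebraMap F K x.1 + algebraMap F K x.2 * (θ * U ^ 3)⁻¹) := by
    intro W
    obtain ⟨a, b, hab⟩ := coord_exists hg.dim hη (W / U)
    exact ⟨(a, b), by rw [← hab]; field_simp⟩
  choose f hf using hco
  have hinj : Function.Injective f := by
    intro W W' h
    rw [hf W, hf W', h]
  rw [← Finset.card_image_of_injective _ hinj]
  set S := Finset.image f {W : K | bfun tr θ U W = 0 ∧ bfun tr θ V W = 0} with hS
  have k1 : ∀ x ∈ S, x.1 ^ 2 + x.1 = N * x.2 ^ 2 := by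
    intro x hx
    rw [hS] at hx
    obtain ⟨W, hW, rfl⟩ := Finset.mem_image.1 hx
    simp only [Finset.mem_filter, Finset.mem_univ, true_and] at hW
    have := hW.1
    rw [hf W] at this
    exact hg.bself hU T N hq _ _ this
  have k2 : ∀ x ∈ S, (c ^ 2 + c + d ^ 2 * N) * x.1 = N * T * d * (x.2 * (x.2 + d)) := by
    intro x hx
    have kk := k1 x hx
    rw [hS] at hx
    obtain ⟨W, hW, rfl⟩ := Finset.mem_image.1 hx
    simp only [Finset.mem_filter, Finset.mem_univ, true_and] at hW
    have := hW.2
    rw [hf W, hVU] at this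
    have := hg.bzero hU T N hq _ _ _ _ this
    linear_combination this - c * kk - (N * T * d * ((f W).2 * ((f W).2 + d))
      + c * N * (f W).2 ^ 2 - c * (f W).1) * h2
  set A := c ^ 2 + c + d ^ 2 * N with hA
  by_cases hd : d = 0
  · have hA0 : A ≠ 0 := by
      intro h
      rw [hA, hd] at h
      have : c * (c + 1) = 0 := by linear_combination h
      rcases mul_eq_zero.1 this with h | h
      · exact hV (by rw [hVU, h, hd]; simp)
      · apply hUV
        have hc : c = 1 := by linear_combination h - h2
        rw [hVU, hc, hd]; simp
    have : S ⊆ {(0, 0)} := by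
      intro x hx
      have e2 := k2 x hx
      have e1 := k1 x hx
      rw [hd] at e2
      have hx1 : x.1 = 0 := by
        have : A * x.1 = 0 := by linear_combination e2
        exact (mul_eq_zero.1 this).resolve_left hA0
      have hx2 : x.2 = 0 := by
        rw [hx1] at e1
        have : N * x.2 ^ 2 = 0 := by linear_combination -e1
        exact pow_eq_zero_iff two_ne_zero |>.1 ((mul_eq_zero.1 this).resolve_left hN)
      rw [Finset.mem_singleton]
      exact Prod.ext hx1 hx2
    exact (Finset.card_le_card this).trans (by simp)
  · let p : Polynomial F :=
      Polynomial.C ((N * T * d) ^ 2) * Polynomial.X ^ 4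
      + Polynomial.C ((N * T * d) ^ 2 * d ^ 2 + A * N * T * d + A ^ 2 * N) * Polynomial.X ^ 2
      + Polynomial.C (A * N * T * d ^ 2) * Polynomial.X
    have hlead : (N * T * d) ^ 2 ≠ 0 := pow_ne_zero 2 (mul_ne_zero (mul_ne_zero hN hT) hd)
    have hpd : p.natDegree = 4 := by simp only [p]; compute_degree!
    have hp : p ≠ 0 := by intro h; rw [h] at hpd; simp at hpd
    refine count_pairs S N p hp 4 hpd.le k1 ?_
    intro x hx
    have e1 := k1 x hx
    have e2 := k2 x hx
    simp only [p, Polynomial.eval_add, Polynomial.eval_mul, Polynomial.eval_pow,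
      Polynomial.eval_X, Polynomial.eval_C]
    set a := x.1
    set b := x.2
    have e3 : A ^ 2 * a ^ 2 = (N * T * d * (b * (b + d))) ^ 2 := by rw [← e2]; ring
    linear_combination -e3 - A * e2 + A ^ 2 * e1 + (A ^ 2 * N * b ^ 2 - (N * T * d) ^ 2 * b ^ 3 * d) * h2

lemma Good.sol (hg : Good tr θ) {X : K} (hX : X ≠ 0) {γ : F} (hγ : γ ≠ 0) :
    #{s : K × F | bfun tr θ X s.1 = 0 ∧
      θ * ((algebraMap F K γ) ^ 2 * s.1 ^ 4 + (algebraMap F K s.2) ^ 2 * X ^ 4)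
        = algebraMap F K γ * s.1 + algebraMap F K s.2 * X} ≤ 16 := by
  have h2 : (2 : F) = 0 := CharTwo.two_eq_zero
  have h2K : (2 : K) = 0 := CharTwo.two_eq_zero
  have hη := hg.eta hX
  obtain ⟨T, N, hT, hN, hq⟩ := coord_quad hg.dim hη
  have hco : ∀ W : K, ∃ x : F × F,
      W = X * (algebraMap F K x.1 + algebraMap F K x.2 * (θ * X ^ 3)⁻¹) := by
    intro W
    obtain ⟨a, b, hab⟩ := coord_exists hg.dim hη (W / X)
    exact ⟨(a, b), by rw [← hab]; field_simp⟩
  choose f hf using hco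
  have hinj : Function.Injective f := by
    intro W W' h
    rw [hf W, hf W', h]
  set S0 : Finset (K × F) := {s : K × F | bfun tr θ X s.1 = 0 ∧
      θ * ((algebraMap F K γ) ^ 2 * s.1 ^ 4 + (algebraMap F K s.2) ^ 2 * X ^ 4)
        = algebraMap F K γ * s.1 + algebraMap F K s.2 * X} with hS0
  have hne : θ * X ^ 3 ≠ 0 := mul_ne_zero hg.theta_ne (pow_ne_zero 3 hX)
  have key : ∀ s ∈ S0, (f s.1).1 ^ 2 + (f s.1).1 = N * (f s.1).2 ^ 2 ∧
      s.2 = γ * ((f s.1).1 + (f s.1).2 * T) + γ ^ 2 * T ^ 3 * (f s.1).2 ^ 4 ∧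
      γ ^ 4 * T ^ 6 * (f s.1).2 ^ 8 + γ ^ 2 * N * T ^ 2 * (f s.1).2 ^ 4
        + γ ^ 2 * T ^ 2 * (f s.1).2 ^ 2 + γ * N * (f s.1).2 = 0 := by
    intro s hs
    simp only [hS0, Finset.mem_filter, Finset.mem_univ, true_and] at hs
    obtain ⟨hB, hE⟩ := hs
    have hB' := hB
    rw [hf s.1] at hB'
    have k1 := hg.bself hX T N hq _ _ hB'
    refine ⟨k1, ?_⟩
    set a := (f s.1).1
    set b := (f s.1).2
    have hfs := hf s.1
    set W := s.1
    set μ := s.2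
    set η := (θ * X ^ 3)⁻¹ with hηd
    have e1 : (θ * X ^ 3) * η = 1 := mul_inv_cancel₀ hne
    have hw : ∃ w, w = algebraMap F K a + algebraMap F K b * η := ⟨_, rfl⟩
    obtain ⟨w, hw⟩ := hw
    have hW : W = X * w := by rw [hw]; exact hfs
    rw [hW] at hE
    have hE2 : algebraMap F K γ ^ 2 * w ^ 4 + algebraMap F K μ ^ 2
        = η * (algebraMap F K γ * w + algebraMap F K μ) := by
      have : X * (algebraMap F K γ ^ 2 * w ^ 4 + algebraMap F K μ ^ 2)
        = X * (η * (algebraMap F K γ * w + algebraMap F K μ)) := by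
        linear_combination η * hE -
          X * (algebraMap F K γ ^ 2 * w ^ 4 + algebraMap F K μ ^ 2) * e1
      exact mul_left_cancel₀ hX this
    have k1K : algebraMap F K a ^ 2 + algebraMap F K a = algebraMap F K N * algebraMap F K b ^ 2 := by
      rw [← map_pow, ← map_pow, ← map_add, ← map_mul, k1]
    have hw2 : w ^ 2 = algebraMap F K a + algebraMap F K b ^ 2 * algebraMap F K T * η := by
      rw [hw]
      linear_combination algebraMap F K b ^ 2 * hq + k1K + (algebraMap F K a * algebraMap F K b * η
        + algebraMap F K N * algebraMap F K b ^ 2 - algebraMap F K a) * h2K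
    have hw4 : w ^ 4 = algebraMap F K a ^ 2 + algebraMap F K b ^ 4 * algebraMap F K T ^ 2 *
        algebraMap F K N + algebraMap F K b ^ 4 * algebraMap F K T ^ 3 * η := by
      have : w ^ 4 = (w ^ 2) ^ 2 := by ring
      rw [this, hw2]
      linear_combination algebraMap F K b ^ 4 * algebraMap F K T ^ 2 * hq +
        (algebraMap F K a * algebraMap F K b ^ 2 * algebraMap F K T * η) * h2K
    rw [hw4, hw] at hE2
    have hz := coord_indep hη (u := γ ^ 2 * (a ^ 2 + b ^ 4 * T ^ 2 * N) + μ ^ 2 - γ * b * N)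
      (v := γ ^ 2 * b ^ 4 * T ^ 3 - (γ * a + μ + γ * b * T)) (by
        simp only [map_add, map_mul, map_pow, map_sub]
        linear_combination hE2 + algebraMap F K γ * algebraMap F K b * hq)
    obtain ⟨z1, z2⟩ := hz
    have hμ : μ = γ * (a + b * T) + γ ^ 2 * T ^ 3 * b ^ 4 := by
      linear_combination -z2 - (γ * (a + b * T)) * h2
    refine ⟨hμ, ?_⟩
    rw [hμ] at z1
    linear_combination z1 - (γ ^ 2 * a ^ 2 + γ ^ 2 * a * b * T - γ * b * N
      + γ * (a + b * T) * (γ ^ 2 * T ^ 3 * b ^ 4)) * h2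
  have hinj2 : Set.InjOn (fun s : K × F => f s.1) S0 := by
    intro s hs s' hs' h
    simp only at h
    have e1 : s.1 = s'.1 := hinj h
    refine Prod.ext e1 ?_
    rw [(key s hs).2.1, (key s' hs').2.1, e1]
  rw [← Finset.card_image_of_injOn hinj2]
  let p : Polynomial F := Polynomial.C (γ ^ 4 * T ^ 6) * Polynomial.X ^ 8
    + Polynomial.C (γ ^ 2 * N * T ^ 2) * Polynomial.X ^ 4
    + Polynomial.C (γ ^ 2 * T ^ 2) * Polynomial.X ^ 2 + Polynomial.C (γ * N) * Polynomial.X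
  have hlead : γ ^ 4 * T ^ 6 ≠ 0 := mul_ne_zero (pow_ne_zero _ hγ) (pow_ne_zero _ hT)
  have hpd : p.natDegree = 8 := by simp only [p]; compute_degree!
  have hp : p ≠ 0 := by intro h; rw [h] at hpd; simp at hpd
  refine count_pairs _ N p hp 8 hpd.le ?_ ?_
  · intro x hx
    obtain ⟨s, hs, rfl⟩ := Finset.mem_image.1 hx
    exact (key s hs).1
  · intro x hx
    obtain ⟨s, hs, rfl⟩ := Finset.mem_image.1 hx
    simp only [p, Polynomial.eval_add, Polynomial.eval_mul, Polynomial.eval_pow,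
      Polynomial.eval_X, Polynomial.eval_C]
    exact (key s hs).2.2

/-- The connection set. -/
def conn (tr : K →ₗ[F] F) (θ : K) : Finset (K × F) :=
  Finset.univ.filter (fun s => s.1 ≠ 0 ∧ s.2 = hfun tr θ s.1)

lemma mem_conn {s : K × F} : s ∈ conn tr θ ↔ s.1 ≠ 0 ∧ s.2 = hfun tr θ s.1 := by
  simp [conn]

lemma addself (s : K × F) : s + s = 0 := by
  ext <;> simp [CharTwo.add_self_eq_zero]

lemma Good.fewCommon (hg : Good tr θ) : FewCommon (conn tr θ) := by
  intro u v hu hv huv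
  rcases Finset.eq_empty_or_nonempty
    {d ∈ conn tr θ | d + u ∈ conn tr θ ∧ d + v ∈ conn tr θ} with he | ⟨d0, hd0⟩
  · rw [he]; simp
  have hB : ∀ (u d : K × F), d ∈ conn tr θ → d + u ∈ conn tr θ →
      bfun tr θ u.1 d.1 = u.2 + hfun tr θ u.1 := by
    intro u d hd hdu
    rw [mem_conn] at hd hdu
    have h1 := hdu.2
    rw [Prod.snd_add, Prod.fst_add, hfun_add, hd.2, bfun_comm] at h1
    have h2 : (2 : F) = 0 := CharTwo.two_eq_zero
    linear_combination -h1 - hfun tr θ u.1 * h2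
  rw [Finset.mem_filter] at hd0
  have hh0 : hfun tr θ 0 = 0 := by simp [hfun]
  have hb0 : ∀ d, bfun tr θ 0 d = 0 := by simp [bfun]
  have nz : ∀ w : K × F, w ≠ 0 → d0 + w ∈ conn tr θ → w.1 ≠ 0 := by
    intro w hw hdw h
    have := hB w d0 hd0.1 hdw
    rw [h, hb0, hh0, add_zero] at this
    exact hw (Prod.ext h this.symm)
  have hu1 := nz u hu hd0.2.1
  have hv1 := nz v hv hd0.2.2
  have huv1 : u.1 ≠ v.1 := by
    intro h
    have e1 := hB u d0 hd0.1 hd0.2.1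
    have e2 := hB v d0 hd0.1 hd0.2.2
    rw [h, e2] at e1
    exact huv (Prod.ext h (add_right_cancel e1).symm)
  refine le_trans ?_ (hg.common hu1 hv1 huv1)
  refine Finset.card_le_card_of_injOn (fun d => d.1 + d0.1) ?_ ?_
  · intro d hd
    simp only [Finset.coe_filter, Set.mem_ofPred_eq] at hd
    simp only [Finset.coe_filter, Set.mem_ofPred_eq, Finset.mem_univ, true_and]
    rw [bfun_add, bfun_add, hB u d hd.1 hd.2.1, hB v d hd.1 hd.2.2, hB u d0 hd0.1 hd0.2.1,
      hB v d0 hd0.1 hd0.2.2]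
    exact ⟨CharTwo.add_self_eq_zero _, CharTwo.add_self_eq_zero _⟩
  · intro d hd d' hd' h
    simp only [Finset.coe_filter, Set.mem_ofPred_eq] at hd hd'
    have h1 : d.1 = d'.1 := add_right_cancel h
    refine Prod.ext h1 ?_
    rw [(mem_conn.1 hd.1).2, (mem_conn.1 hd'.1).2, h1]

/-- Positive-type lower bound from character sums. -/
lemma bochner {G I : Type} [AddCommGroup G] [Fintype G] [DecidableEq G] [Fintype I]
    (hG : ∀ a : G, a + a = 0) (χ : I → G → ℝ) (hmul : ∀ i a b, χ i (a + b) = χ i a * χ i b)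
    (n : ℝ) (hn : 0 < n) (horth : ∀ g, ∑ i, χ i g = if g = 0 then n else 0)
    {J : Type} (S : Finset J) (s : J → G) (m : ℝ) (hm : ∀ i, -m ≤ ∑ j ∈ S, χ i (s j))
    (g : G → ℝ) : -(m * ∑ a, g a ^ 2) ≤ ∑ j ∈ S, ∑ a, g a * g (a + s j) := by
  have pars : ∀ x : G, ∑ i, (∑ a, g a * χ i a) ^ 2 * χ i x = n * ∑ a, g a * g (a + x) := by
    intro x
    have h1 : ∀ i, (∑ a, g a * χ i a) ^ 2 * χ i x = ∑ a, ∑ b, g a * g b * χ i (a + b + x) := by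
      intro i
      rw [sq, Finset.sum_mul_sum, Finset.sum_mul]
      refine Finset.sum_congr rfl fun a _ => ?_
      rw [Finset.sum_mul]
      refine Finset.sum_congr rfl fun b _ => ?_
      rw [hmul, hmul]; ring
    simp only [h1]
    rw [Finset.sum_comm, Finset.mul_sum]
    refine Finset.sum_congr rfl fun a _ => ?_
    rw [Finset.sum_comm]
    simp only [← Finset.mul_sum, horth]
    rw [Finset.sum_eq_single (a + x)]
    · rw [if_pos]
      · ring
      · rw [show a + (a + x) + x = (a + x) + (a + x) by abel]; exact hG _
    · intro b _ hb
      rw [if_neg, mul_zero]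
      intro h
      apply hb
      rw [← add_eq_zero_two hG, ← h]; abel
    · simp
  have hχ0 : ∀ i, χ i 0 = 1 ∨ (χ i 0 = 0) := by
    intro i
    have := hmul i 0 0
    rw [add_zero] at this
    have h : χ i 0 * (χ i 0 - 1) = 0 := by linarith
    rcases mul_eq_zero.1 h with h | h
    · right; exact h
    · left; linarith
  have p0 := pars 0
  simp only [add_zero] at p0
  have hle : ∀ i, -(m * ((∑ a, g a * χ i a) ^ 2 * χ i 0)) ≤
      (∑ a, g a * χ i a) ^ 2 * ∑ j ∈ S, χ i (s j) := by
    intro i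
    rcases hχ0 i with h | h
    · rw [h, mul_one]
      have := mul_le_mul_of_nonneg_left (hm i) (sq_nonneg (∑ a, g a * χ i a))
      linarith
    · have hz : ∀ a, χ i a = 0 := by
        intro a
        have := hmul i a 0
        rwa [add_zero, h, mul_zero] at this
      simp [hz]
  have hsum := Finset.sum_le_sum fun i (_ : i ∈ Finset.univ) => hle i
  rw [Finset.sum_neg_distrib, ← Finset.mul_sum, p0] at hsum
  have hr : ∑ i, (∑ a, g a * χ i a) ^ 2 * ∑ j ∈ S, χ i (s j)
      = n * ∑ j ∈ S, ∑ a, g a * g (a + s j) := by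
    simp only [Finset.mul_sum (s := S)]
    rw [Finset.sum_comm]
    exact Finset.sum_congr rfl fun j _ => pars (s j)
  rw [hr] at hsum
  have e : ∑ a, g a * g a = ∑ a, g a ^ 2 := Finset.sum_congr rfl fun a _ => by ring
  rw [e] at hsum
  by_contra hcon
  push Not at hcon
  have := mul_lt_mul_of_pos_left hcon hn
  linarith

/-- a real character sums to something nonnegative over a subgroup -/
lemma subgroup_sum_nonneg {A : Type} [AddCommGroup A] [DecidableEq A] (U : Finset A)
    (hadd : ∀ a ∈ U, ∀ b ∈ U, a + b ∈ U) (f : A → ℝ)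
    (hf : ∀ a b, f (a + b) = f a * f b) : 0 ≤ ∑ a ∈ U, f a := by
  by_cases h : ∀ a ∈ U, f a = 1
  · exact Finset.sum_nonneg fun a ha => by rw [h a ha]; exact zero_le_one
  · push Not at h
    obtain ⟨u, hu, hfu⟩ := h
    have himg : U.image (fun a => u + a) = U := by
      apply Finset.eq_of_subset_of_card_le
      · intro x hx
        obtain ⟨a, ha, rfl⟩ := Finset.mem_image.1 hx
        exact hadd u hu a ha
      · rw [Finset.card_image_of_injective _ (add_right_injective u)]
    have : ∑ a ∈ U, f a = f u * ∑ a ∈ U, f a := by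
      conv_lhs => rw [← himg]
      rw [Finset.sum_image (fun a _ b _ h => add_right_injective u h), Finset.mul_sum]
      exact Finset.sum_congr rfl fun a _ => hf u a
    have h3 : (f u - 1) * ∑ a ∈ U, f a = 0 := by linarith
    rcases mul_eq_zero.1 h3 with h4 | h4
    · exact absurd (by linarith) hfu
    · exact h4.ge

/-- the subgroup orthogonal to `X` -/
def orth (tr : K →ₗ[F] F) (θ X : K) : Finset K := Finset.univ.filter (fun Y => bfun tr θ X Y = 0)

lemma mem_orth {X Y : K} : Y ∈ orth tr θ X ↔ bfun tr θ X Y = 0 := by simp [orth]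

lemma orth_add {X Y Z : K} (hY : Y ∈ orth tr θ X) (hZ : Z ∈ orth tr θ X) :
    Y + Z ∈ orth tr θ X := by
  rw [mem_orth] at *
  rw [bfun_add, hY, hZ, add_zero]

/-- Character hypotheses. -/
structure GoodChar (tr : K →ₗ[F] F) (e : AddChar F ℝ) (ψ : AddChar K ℝ) : Prop where
  e_ne : e ≠ 1
  psi_ne : ψ ≠ 1
  comp : ∀ u, e (tr u) = ψ u
  sq : ∀ u, ψ (u ^ 2) = ψ u

variable {e : AddChar F ℝ} {ψ : AddChar K ℝ}

lemma char_sq (u : F) : e u * e u = 1 := by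
  rw [← AddChar.map_add_eq_mul, CharTwo.add_self_eq_zero, AddChar.map_zero_eq_one]

lemma char_sqK (u : K) : ψ u * ψ u = 1 := by
  rw [← AddChar.map_add_eq_mul, CharTwo.add_self_eq_zero, AddChar.map_zero_eq_one]

lemma GoodChar.inner_sum (hg : Good tr θ) (hc : GoodChar tr e ψ) {X : K} (γ : F) (W : K) :
    (Fintype.card F : ℝ) * ∑ Y ∈ orth tr θ X, e (γ * bfun tr θ W Y)
      = ∑ μ : F, if θ * ((algebraMap F K γ) ^ 2 * W ^ 4 + (algebraMap F K μ) ^ 2 * X ^ 4)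
        = algebraMap F K γ * W + algebraMap F K μ * X then (Fintype.card K : ℝ) else 0 := by
  have h1 : ∀ Y, ∑ μ : F, e (μ * bfun tr θ X Y) =
      if bfun tr θ X Y = 0 then (Fintype.card F : ℝ) else 0 := by
    intro Y
    have := AddChar.sum_mulShift (ψ := e) (bfun tr θ X Y) (AddChar.IsPrimitive.of_ne_one hc.e_ne)
    exact_mod_cast this
  have h2 : (Fintype.card F : ℝ) * ∑ Y ∈ orth tr θ X, e (γ * bfun tr θ W Y)
      = ∑ Y : K, ∑ μ : F, e (μ * bfun tr θ X Y) * e (γ * bfun tr θ W Y) := by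
    simp only [← Finset.sum_mul, h1]
    rw [Finset.mul_sum, orth, Finset.sum_filter]
    refine Finset.sum_congr rfl fun Y _ => ?_
    split_ifs <;> simp
  rw [h2, Finset.sum_comm]
  refine Finset.sum_congr rfl fun μ _ => ?_
  have h2K : (2 : K) = 0 := CharTwo.two_eq_zero
  set g := algebraMap F K γ
  set m := algebraMap F K μ
  have h3 : ∀ Y : K, e (μ * bfun tr θ X Y) * e (γ * bfun tr θ W Y)
      = ψ (Y ^ 2 * (θ ^ 2 * (g ^ 2 * W ^ 4 + m ^ 2 * X ^ 4) + θ * (g * W + m * X))) := by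
    intro Y
    unfold bfun
    rw [← smul_eq_mul (a := μ), ← smul_eq_mul (a := γ), ← map_smul, ← map_smul, hc.comp, hc.comp,
      Algebra.smul_def, Algebra.smul_def, ← AddChar.map_add_eq_mul]
    have e1 : m * (θ * (X ^ 2 * Y + X * Y ^ 2)) + g * (θ * (W ^ 2 * Y + W * Y ^ 2))
      = (θ * (m * X ^ 2 + g * W ^ 2) * Y) + Y ^ 2 * θ * (g * W + m * X) := by ring
    rw [e1, AddChar.map_add_eq_mul, ← hc.sq (θ * (m * X ^ 2 + g * W ^ 2) * Y),
      ← AddChar.map_add_eq_mul]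
    congr 1
    linear_combination (θ ^ 2 * Y ^ 2 * m * X ^ 2 * g * W ^ 2) * h2K
  simp only [h3]
  have hbij : Function.Bijective (fun Y : K => Y ^ 2) := by
    rw [← Finite.injective_iff_bijective]
    intro x y hxy
    simp only at hxy
    have : (x - y) ^ 2 = 0 := by
      linear_combination hxy + (y ^ 2 - x * y) * h2K
    exact sub_eq_zero.1 (pow_eq_zero_iff two_ne_zero |>.1 this)
  rw [Function.Bijective.sum_comp hbij
    (fun Z => ψ (Z * (θ ^ 2 * (g ^ 2 * W ^ 4 + m ^ 2 * X ^ 4) + θ * (g * W + m * X))))]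
  have := AddChar.sum_mulShift (ψ := ψ)
    (θ ^ 2 * (g ^ 2 * W ^ 4 + m ^ 2 * X ^ 4) + θ * (g * W + m * X))
    (AddChar.IsPrimitive.of_ne_one hc.psi_ne)
  rw [this]
  have hiff : θ ^ 2 * (g ^ 2 * W ^ 4 + m ^ 2 * X ^ 4) + θ * (g * W + m * X) = 0 ↔
      θ * (g ^ 2 * W ^ 4 + m ^ 2 * X ^ 4) = g * W + m * X := by
    constructor
    · intro h
      have : θ * (θ * (g ^ 2 * W ^ 4 + m ^ 2 * X ^ 4)) = θ * (g * W + m * X) := by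
        linear_combination h - θ * (g * W + m * X) * h2K
      exact mul_left_cancel₀ hg.theta_ne this
    · intro h
      linear_combination θ * h + θ * (g * W + m * X) * h2K
  split_ifs <;> simp_all

lemma GoodChar.esum_sq (hg : Good tr θ) (hc : GoodChar tr e ψ)
    (hcard : Fintype.card K = Fintype.card F ^ 2) {X : K} (hX : X ≠ 0) (β : K)
    {γ : F} (hγ : γ ≠ 0) :
    (∑ Y ∈ orth tr θ X, ψ (β * Y) * e (γ * hfun tr θ Y)) ^ 2 ≤ 16 * Fintype.card F := by
  set U := orth tr θ X with hU
  have hq : (0 : ℝ) < Fintype.card F := by exact_mod_cast Fintype.card_pos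
  have hexp : (∑ Y ∈ U, ψ (β * Y) * e (γ * hfun tr θ Y)) ^ 2
      = ∑ W ∈ U, ψ (β * W) * e (γ * hfun tr θ W) * ∑ Y ∈ U, e (γ * bfun tr θ W Y) := by
    rw [_root_.sq, Finset.sum_mul_sum]
    simp only [Finset.mul_sum]
    rw [Finset.sum_comm (s := U) (t := U)
      (f := fun W Y => ψ (β * W) * e (γ * hfun tr θ W) * e (γ * bfun tr θ W Y))]
    refine Finset.sum_congr rfl fun Y hY => ?_
    refine Finset.sum_nbij' (fun Z => Y + Z) (fun W => Y + W) ?_ ?_ ?_ ?_ ?_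
    · intro Z hZ; exact orth_add hY hZ
    · intro Z hZ; exact orth_add hY hZ
    · intro Z _
      rw [← add_assoc, CharTwo.add_self_eq_zero, zero_add]
    · intro Z _
      rw [← add_assoc, CharTwo.add_self_eq_zero, zero_add]
    · intro Z _
      have hs1 : hfun tr θ (Y + Z) = hfun tr θ Y + hfun tr θ Z + bfun tr θ Y Z := hfun_add _ _ _ _
      have hs2 : bfun tr θ (Y + Z) Y = bfun tr θ Y Z := by
        rw [bfun_comm, bfun_add]
        have : bfun tr θ Y Y = 0 := by
          unfold bfun
          rw [show θ * (Y ^ 2 * Y + Y * Y ^ 2) = 0 by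
            have h2K : (2 : K) = 0 := CharTwo.two_eq_zero
            linear_combination θ * Y ^ 3 * h2K, map_zero]
        rw [this, zero_add]
      rw [hs1, hs2, mul_add, mul_add, mul_add, AddChar.map_add_eq_mul, AddChar.map_add_eq_mul,
        AddChar.map_add_eq_mul]
      have := char_sq (e := e) (γ * bfun tr θ Y Z)
      linear_combination (-(ψ (β * Y) * ψ (β * Z) * e (γ * hfun tr θ Y) * e (γ * hfun tr θ Z))) * this
  have hnn : ∀ W, 0 ≤ ∑ Y ∈ U, e (γ * bfun tr θ W Y) := by
    intro W
    refine subgroup_sum_nonneg U (fun a ha b hb => orth_add ha hb)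
      (fun Y => e (γ * bfun tr θ W Y)) ?_
    intro a b
    rw [bfun_add, mul_add, AddChar.map_add_eq_mul]
  have hle1 : ∀ W, ψ (β * W) * e (γ * hfun tr θ W) ≤ 1 := by
    intro W
    have h1 := char_sq (e := e) (γ * hfun tr θ W)
    have h2 := char_sqK (ψ := ψ) (β * W)
    have : (ψ (β * W) * e (γ * hfun tr θ W)) ^ 2 = 1 := by
      calc _ = (ψ (β * W) * ψ (β * W)) * (e (γ * hfun tr θ W) * e (γ * hfun tr θ W)) := by ring
        _ = 1 := by rw [h1, h2]; norm_num
    nlinarith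
  have hb : (∑ Y ∈ U, ψ (β * Y) * e (γ * hfun tr θ Y)) ^ 2
      ≤ ∑ W ∈ U, ∑ Y ∈ U, e (γ * bfun tr θ W Y) := by
    rw [hexp]
    refine Finset.sum_le_sum fun W _ => ?_
    calc _ ≤ 1 * ∑ Y ∈ U, e (γ * bfun tr θ W Y) :=
          mul_le_mul_of_nonneg_right (hle1 W) (hnn W)
      _ = _ := one_mul _
  have hsol := hg.sol hX hγ
  have hcnt : (Fintype.card F : ℝ) * ∑ W ∈ U, ∑ Y ∈ U, e (γ * bfun tr θ W Y)
      ≤ 16 * Fintype.card K := by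
    rw [Finset.mul_sum]
    simp only [hU, hc.inner_sum hg γ]
    rw [← hU]
    have : ∑ W ∈ U, ∑ μ : F, (if θ * ((algebraMap F K γ) ^ 2 * W ^ 4
        + (algebraMap F K μ) ^ 2 * X ^ 4) = algebraMap F K γ * W + algebraMap F K μ * X
        then (Fintype.card K : ℝ) else 0)
        = (#{s : K × F | bfun tr θ X s.1 = 0 ∧
      θ * ((algebraMap F K γ) ^ 2 * s.1 ^ 4 + (algebraMap F K s.2) ^ 2 * X ^ 4)
        = algebraMap F K γ * s.1 + algebraMap F K s.2 * X} : ℝ) * Fintype.card K := by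
      rw [Finset.card_filter, Fintype.sum_prod_type, hU, orth, Finset.sum_filter]
      push_cast
      rw [Finset.sum_mul]
      refine Finset.sum_congr rfl fun W _ => ?_
      rw [Finset.sum_mul]
      by_cases hW : bfun tr θ X W = 0
      · rw [if_pos hW]
        refine Finset.sum_congr rfl fun μ _ => ?_
        simp [hW]
      · rw [if_neg hW]
        simp [hW]
    rw [this]
    exact mul_le_mul_of_nonneg_right (by exact_mod_cast hsol) (Nat.cast_nonneg _)
  rw [hcard] at hcnt
  push_cast at hcnt
  have : ∑ W ∈ U, ∑ Y ∈ U, e (γ * bfun tr θ W Y) ≤ 16 * Fintype.card F := by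
    refine le_of_mul_le_mul_left ?_ hq
    linarith
  exact hb.trans this

lemma GoodChar.esum (hg : Good tr θ) (hc : GoodChar tr e ψ)
    (hcard : Fintype.card K = Fintype.card F ^ 2) {X : K} (hX : X ≠ 0) (β : K) (γ : F) :
    -(4 * √(Fintype.card F)) ≤ ∑ Y ∈ orth tr θ X, ψ (β * Y) * e (γ * hfun tr θ Y) := by
  by_cases hγ : γ = 0
  · subst hγ
    have : 0 ≤ ∑ Y ∈ orth tr θ X, ψ (β * Y) * e (0 * hfun tr θ Y) := by
      simp only [zero_mul, AddChar.map_zero_eq_one, mul_one]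
      refine subgroup_sum_nonneg _ (fun a ha b hb => orth_add ha hb) (fun Y => ψ (β * Y)) ?_
      intro a b
      rw [mul_add, AddChar.map_add_eq_mul]
    have h0 := Real.sqrt_nonneg (Fintype.card F : ℝ)
    linarith
  · have h := hc.esum_sq hg hcard hX β hγ
    have h2 : |∑ Y ∈ orth tr θ X, ψ (β * Y) * e (γ * hfun tr θ Y)| ≤ 4 * √(Fintype.card F) := by
      apply abs_le_of_sq_le_sq _ (by positivity)
      rw [mul_pow, Real.sq_sqrt (Nat.cast_nonneg _)]
      linarith
    exact (abs_le.1 h2).1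

lemma rdelta_eq {X : K} (hX : X ≠ 0) :
    {ε ∈ conn tr θ | ε + (X, hfun tr θ X) ∈ conn tr θ}
      = (((orth tr θ X).erase 0).erase X).image (fun Y => (Y, hfun tr θ Y)) := by
  ext ⟨Y, y⟩
  simp only [Finset.mem_filter, mem_conn, Finset.mem_image, Finset.mem_erase, mem_orth,
    Prod.mk_add_mk, Prod.mk.injEq]
  have h2 : (2 : F) = 0 := CharTwo.two_eq_zero
  constructor
  · rintro ⟨⟨h1, h3⟩, h4, h5⟩
    refine ⟨Y, ⟨?_, h1, ?_⟩, rfl, h3.symm⟩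
    · rintro rfl
      exact h4 (CharTwo.add_self_eq_zero _)
    · rw [hfun_add, h3, bfun_comm] at h5
      linear_combination -h5
  · rintro ⟨Y', ⟨h1, h3, h4⟩, rfl, rfl⟩
    refine ⟨⟨h3, rfl⟩, ?_, ?_⟩
    · intro h
      apply h1
      have h2K : (2 : K) = 0 := CharTwo.two_eq_zero
      linear_combination h - X * h2K
    · rw [hfun_add, bfun_comm, h4, add_zero]

lemma orth_self {X : K} : X ∈ orth tr θ X := by
  rw [mem_orth]
  unfold bfun
  rw [show θ * (X ^ 2 * X + X * X ^ 2) = 0 by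
    have h2K : (2 : K) = 0 := CharTwo.two_eq_zero
    linear_combination θ * X ^ 3 * h2K, map_zero]

lemma orth_zero {X : K} : (0 : K) ∈ orth tr θ X := by
  rw [mem_orth]; simp [bfun]

lemma rdelta_sum {X : K} (hX : X ≠ 0) (H : K × F → ℝ) :
    ∑ Y ∈ orth tr θ X, H (Y, hfun tr θ Y)
      = ∑ ε ∈ conn tr θ with ε + (X, hfun tr θ X) ∈ conn tr θ, H ε
        + H (X, hfun tr θ X) + H 0 := by
  rw [rdelta_eq hX, Finset.sum_image (fun a _ b _ h => (Prod.mk.inj h).1),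
    Finset.sum_erase_add _ (f := fun Y => H (Y, hfun tr θ Y)) (Finset.mem_erase.2 ⟨hX, orth_self⟩)]
  have h0 : (0 : K × F) = (0, hfun tr θ 0) := Prod.ext rfl (by simp [hfun])
  rw [h0, Finset.sum_erase_add _ (f := fun Y => H (Y, hfun tr θ Y)) orth_zero]

lemma GoodChar.spec (hg : Good tr θ) (hc : GoodChar tr e ψ)
    (hcard : Fintype.card K = Fintype.card F ^ 2) :
    Spec (conn tr θ) (4 * √(Fintype.card F) + 2) := by
  rintro ⟨X, x⟩ hδ g
  rw [mem_conn] at hδ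
  obtain ⟨hX, hx⟩ := hδ
  simp only at hX hx
  subst hx
  have hb := bochner (G := K × F) (I := K × F) addself
    (fun i a => ψ (i.1 * a.1) * e (i.2 * a.2))
    (by intro i a b; simp only [Prod.fst_add, Prod.snd_add, mul_add, AddChar.map_add_eq_mul]; ring)
    (Fintype.card K * Fintype.card F)
    (by
      have h1 : (0 : ℝ) < Fintype.card F := by exact_mod_cast Fintype.card_pos
      have h2 : (0 : ℝ) < Fintype.card K := by exact_mod_cast Fintype.card_pos
      positivity)
    (by
      rintro ⟨Y, y⟩
      rw [Fintype.sum_prod_type]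
      simp only [← Finset.sum_mul_sum]
      have a1 := AddChar.sum_mulShift (ψ := ψ) Y (AddChar.IsPrimitive.of_ne_one hc.psi_ne)
      have a2 := AddChar.sum_mulShift (ψ := e) y (AddChar.IsPrimitive.of_ne_one hc.e_ne)
      rw [a1, a2]
      by_cases hY : Y = 0 <;> by_cases hy : y = 0 <;> simp [hY, hy])
    (orth tr θ X) (fun Y => (Y, hfun tr θ Y)) (4 * √(Fintype.card F))
    (fun i => hc.esum hg hcard hX i.1 i.2) g
  rw [rdelta_sum hX (fun ε => ∑ a, g a * g (a + ε))] at hb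
  have t1 : ∑ a, g a * g (a + 0) = ∑ a, g a ^ 2 :=
    Finset.sum_congr rfl fun a _ => by rw [add_zero]; ring
  have t2 : ∑ a, g a * g (a + (X, hfun tr θ X)) ≤ ∑ a, g a ^ 2 := by
    have s1 : ∑ a, g (a + (X, hfun tr θ X)) ^ 2 = ∑ a, g a ^ 2 :=
      Fintype.sum_equiv (Equiv.addRight (X, hfun tr θ X)) _ _ (fun _ => rfl)
    have s2 : ∑ a, 2 * (g a * g (a + (X, hfun tr θ X)))
        ≤ ∑ a, (g a ^ 2 + g (a + (X, hfun tr θ X)) ^ 2) :=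
      Finset.sum_le_sum fun a _ => by nlinarith [sq_nonneg (g a - g (a + (X, hfun tr θ X)))]
    rw [Finset.sum_add_distrib, s1, ← Finset.mul_sum] at s2
    linarith
  linarith

lemma orth_card (hcard : Fintype.card K = Fintype.card F ^ 2) (X : K) :
    Fintype.card F ≤ #(orth tr θ X) := by
  have h : #(Finset.univ : Finset K) ≤ #(orth tr θ X)
      * #(Finset.univ.image (fun Y => bfun tr θ X Y)) := by
    refine Finset.card_le_mul_card_image (f := fun Y => bfun tr θ X Y) _ _ ?_
    intro b hb
    obtain ⟨Y0, _, rfl⟩ := Finset.mem_image.1 hb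
    refine Finset.card_le_card_of_injOn (fun Y => Y + Y0) ?_ ?_
    · intro Y hY
      simp only [Finset.coe_filter, Set.mem_ofPred_eq, Finset.mem_univ, true_and] at hY
      rw [Finset.mem_coe, mem_orth, bfun_add, hY, CharTwo.add_self_eq_zero]
    · intro a _ b _ h
      exact add_right_cancel h
  have h2 : #(Finset.univ.image (fun Y => bfun tr θ X Y)) ≤ Fintype.card F := Finset.card_le_univ _
  rw [Finset.card_univ, hcard] at h
  have hpos : 0 < Fintype.card F := Fintype.card_pos
  have h3 := h.trans (Nat.mul_le_mul_left _ h2)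
  rw [sq] at h3
  exact Nat.le_of_mul_le_mul_right h3 hpos

lemma rdelta_card (hcard : Fintype.card K = Fintype.card F ^ 2) :
    ∀ δ ∈ conn tr θ, (Fintype.card F : ℝ) - 2 ≤
      (#{ε ∈ conn tr θ | ε + δ ∈ conn tr θ} : ℕ) := by
  rintro ⟨X, x⟩ hδ
  rw [mem_conn] at hδ
  obtain ⟨hX, hx⟩ := hδ
  simp only at hX hx
  subst hx
  have h := rdelta_sum (tr := tr) (θ := θ) hX (fun _ => 1)
  simp only [Finset.sum_const, nsmul_eq_mul, mul_one] at h
  have h2 : (Fintype.card F : ℝ) ≤ #(orth tr θ X) := by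
    exact_mod_cast orth_card (tr := tr) (θ := θ) hcard X
  linarith

end Alg

section Exist

lemma exists_noncube (K : Type) [Field K] [Fintype K] (h : 3 ∣ Fintype.card K - 1) :
    ∃ η : K, η ≠ 0 ∧ ∀ X : K, X ^ 3 ≠ η := by
  classical
  by_contra hcon
  push Not at hcon
  have hsurj : Function.Surjective (fun x : Kˣ => x ^ 3) := by
    intro y
    obtain ⟨X, hX⟩ := hcon y.1 y.ne_zero
    have hX0 : X ≠ 0 := by
      rintro rfl
      exact y.ne_zero (by rw [← hX]; simp)
    exact ⟨Units.mk0 X hX0, by ext; simpa using hX⟩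
  have hinj := Finite.injective_iff_surjective.mpr hsurj
  have : Fact (Nat.Prime 3) := ⟨Nat.prime_three⟩
  obtain ⟨g, hg⟩ := exists_prime_orderOf_dvd_card (G := Kˣ) 3 (by rwa [Fintype.card_units])
  have h1 : g = 1 := hinj (by
    change g ^ 3 = 1 ^ 3
    rw [one_pow, ← hg, pow_orderOf_eq_one])
  rw [h1, orderOf_one] at hg
  omega

lemma exists_cube (F : Type) [Field F] [Fintype F] (h : (Fintype.card F - 1).Coprime 3)
    (a : F) : ∃ b : F, b ^ 3 = a := by
  classical
  by_cases ha : a = 0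
  · exact ⟨0, by simp [ha]⟩
  · have h' : (Nat.card Fˣ).Coprime 3 := by
      rwa [Nat.card_eq_fintype_card, Fintype.card_units]
    obtain ⟨b, hb⟩ := (powCoprime h').surjective (Units.mk0 a ha)
    refine ⟨b.1, ?_⟩
    have := congrArg Units.val hb
    simpa using this

/-- The sign character of the field with two elements. -/
noncomputable def signChar : AddChar (ZMod 2) ℝ where
  toFun := fun u => if u = 0 then 1 else -1
  map_zero_eq_one' := by simp
  map_add_eq_mul' := by
    intro a b
    have h2 : ∀ w : ZMod 2, w = 0 ∨ w = 1 := by decide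
    have h11 : (1 : ZMod 2) + 1 = 0 := by decide
    rcases h2 a with rfl | rfl <;> rcases h2 b with rfl | rfl <;> simp [h11]

lemma signChar_one : signChar 1 = -1 := by
  change (if (1 : ZMod 2) = 0 then (1 : ℝ) else -1) = -1
  simp

/-- The canonical additive character of a field of characteristic two. -/
noncomputable def trChar (F : Type) [Field F] [Algebra (ZMod 2) F] : AddChar F ℝ :=
  signChar.compAddMonoidHom (Algebra.trace (ZMod 2) F).toAddMonoidHom

lemma trChar_apply (F : Type) [Field F] [Algebra (ZMod 2) F] (u : F) :
    trChar F u = signChar (Algebra.trace (ZMod 2) F u) := rfl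

lemma trChar_ne (F : Type) [Field F] [Finite F] [Algebra (ZMod 2) F] : trChar F ≠ 1 := by
  intro h
  have h1 : Algebra.trace (ZMod 2) F ≠ 0 := Algebra.trace_ne_zero _ _
  apply h1
  ext u
  have h2 : trChar F u = 1 := by rw [h]; rfl
  rw [trChar_apply] at h2
  by_contra hne
  have h3 : Algebra.trace (ZMod 2) F u = 1 := by
    have hne' : Algebra.trace (ZMod 2) F u ≠ 0 := hne
    generalize Algebra.trace (ZMod 2) F u = w at hne'
    revert w; decide
  rw [h3, signChar_one] at h2
  norm_num at h2

lemma trChar_sq (F : Type) [Field F] [Finite F] [Algebra (ZMod 2) F] (u : F) :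
    trChar F (u ^ 2) = trChar F u := by
  rw [trChar_apply, trChar_apply]
  congr 1
  have := Algebra.trace_eq_of_algEquiv (FiniteField.frobeniusAlgEquivOfAlgebraic (ZMod 2) F) u
  simpa using this

theorem exists_config (k : ℕ) (hk : Odd k) :
    ∃ (G : Type) (_ : AddCommGroup G) (_ : Fintype G) (_ : DecidableEq G) (D : Finset G),
      (∀ a : G, a + a = 0) ∧ 0 ∉ D ∧ Fintype.card G = (2 ^ k) ^ 3 ∧ 0 < #D ∧ FewCommon D ∧
      Spec D (4 * √(2 ^ k : ℝ) + 2) ∧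
      ∀ δ ∈ D, (2 ^ k : ℝ) - 2 ≤ (#{ε ∈ D | ε + δ ∈ D} : ℕ) := by
  classical
  have : Fact (Nat.Prime 2) := ⟨Nat.prime_two⟩
  have hk0 : k ≠ 0 := by rintro rfl; simp at hk
  let F := GaloisField 2 k
  let : Fintype F := Fintype.ofFinite F
  let K := FiniteField.Extension F 2 2
  let : Fintype K := Fintype.ofFinite K
  have : CharP K 2 := charP_of_injective_algebraMap (algebraMap F K).injective 2
  have hcF : Fintype.card F = 2 ^ k := by
    rw [← Nat.card_eq_fintype_card]; exact GaloisField.card 2 k hk0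
  have hcard : Fintype.card K = Fintype.card F ^ 2 := by
    rw [← Nat.card_eq_fintype_card, ← Nat.card_eq_fintype_card]
    exact FiniteField.natCard_extension F 2 2
  have hdim : Module.finrank F K = 2 := FiniteField.finrank_extension F 2 2
  have hmod : 2 ^ k % 3 = 2 := by
    obtain ⟨m, rfl⟩ := hk
    rw [pow_add, pow_mul, Nat.mul_mod, Nat.pow_mod]
    norm_num
  have hF3 : (Fintype.card F - 1).Coprime 3 := by
    rw [hcF, Nat.coprime_comm, Nat.Prime.coprime_iff_not_dvd Nat.prime_three]
    omega
  have hK3 : 3 ∣ Fintype.card K - 1 := by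
    have h1 : (2 ^ k) ^ 2 % 3 = 1 := by rw [Nat.pow_mod, hmod]
    rw [hcard, hcF]
    omega
  obtain ⟨η, hη0, hη⟩ := exists_noncube K hK3
  have hg : Good (Algebra.trace F K) η⁻¹ := by
    refine ⟨hdim, ?_, ?_⟩
    · have hF0 : ∀ a : F, Algebra.trace F K (algebraMap F K a) = 0 := by
        intro a
        rw [Algebra.trace_algebraMap, hdim, two_nsmul]
        exact CharTwo.add_self_eq_zero a
      intro u
      constructor
      · intro hu
        by_contra hne
        push Not at hne
        have h1 : Algebra.trace F K ≠ 0 := Algebra.trace_ne_zero _ _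
        apply h1
        ext w
        obtain ⟨a, b, rfl⟩ := coord_exists hdim hne w
        rw [map_add, hF0, ← Algebra.smul_def, map_smul, hu]
        simp
      · rintro ⟨a, rfl⟩
        exact hF0 a
    · intro X hX a ha
      obtain ⟨b, rfl⟩ := exists_cube F hF3 a
      have hb : algebraMap F K b ≠ 0 := by
        intro hb
        rw [map_pow, hb] at ha
        have : η⁻¹ * X ^ 3 ≠ 0 := mul_ne_zero (inv_ne_zero hη0) (pow_ne_zero _ hX)
        apply this
        rw [← ha]; simp
      apply hη (X / algebraMap F K b)
      rw [map_pow] at ha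
      have hX3 : X ^ 3 ≠ 0 := pow_ne_zero _ hX
      rw [div_pow, ha, div_eq_iff (mul_ne_zero (inv_ne_zero hη0) hX3), ← mul_assoc,
        mul_inv_cancel₀ hη0, one_mul]
  have hc : GoodChar (Algebra.trace F K) (trChar F) (trChar K) := by
    refine ⟨trChar_ne F, trChar_ne K, ?_, trChar_sq K⟩
    intro u
    rw [trChar_apply, trChar_apply, Algebra.trace_trace]
  have hsp := hc.spec hg hcard
  have hr := rdelta_card (tr := Algebra.trace F K) (θ := η⁻¹) hcard
  have hcF' : (Fintype.card F : ℝ) = 2 ^ k := by rw [hcF]; push_cast; rfl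
  rw [hcF'] at hsp hr
  refine ⟨K × F, inferInstance, inferInstance, inferInstance, conn (Algebra.trace F K) η⁻¹,
    addself, ?_, ?_, ?_, hg.fewCommon, hsp, hr⟩
  · rw [mem_conn]; simp
  · rw [Fintype.card_prod, hcard, hcF]; ring
  · rw [Finset.card_pos]
    exact ⟨((1 : K), hfun (Algebra.trace F K) η⁻¹ 1), by rw [mem_conn]; simp⟩

end Exist

section Assembly

lemma quad_form_le {n k : ℕ} (M : Matrix (Fin k → Fin n) (Fin k → Fin n) ℝ)
    (z : (Fin k → Fin n) → ℝ) :
    ∑ I, ∑ J, z I * M I J * z J ≤ maxEig M * ∑ I, z I ^ 2 := by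
  have hbdd : BddAbove {y | ∃ z : (Fin k → Fin n) → ℝ, (∑ I, z I ^ 2) = 1 ∧
      y = ∑ I, ∑ J, z I * M I J * z J} := by
    refine ⟨∑ I, ∑ J, |M I J|, ?_⟩
    rintro y ⟨w, hw, rfl⟩
    have hw1 : ∀ I, |w I| ≤ 1 := by
      intro I
      rw [← sq_le_one_iff_abs_le_one, ← hw]
      exact Finset.single_le_sum (f := fun I => w I ^ 2) (fun _ _ => sq_nonneg _)
        (Finset.mem_univ I)
    refine Finset.sum_le_sum fun I _ => Finset.sum_le_sum fun J _ => ?_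
    calc w I * M I J * w J ≤ |w I * M I J * w J| := le_abs_self _
      _ = |w I| * |M I J| * |w J| := by rw [abs_mul, abs_mul]
      _ ≤ 1 * |M I J| * 1 := by
          gcongr
          · exact hw1 I
          · exact hw1 J
      _ = |M I J| := by ring
  set S := ∑ I, z I ^ 2 with hS
  have hS0 : 0 ≤ S := Finset.sum_nonneg fun _ _ => sq_nonneg _
  rcases hS0.eq_or_lt with h0 | hpos
  · have hz : ∀ I, z I = 0 := by
      intro I
      have := (Finset.sum_eq_zero_iff_of_nonneg (fun I _ => sq_nonneg (z I))).mp
        (hS.symm.trans h0.symm) I (Finset.mem_univ I)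
      exact pow_eq_zero_iff (two_ne_zero) |>.mp this
    rw [← h0]
    simp [hz]
  · have hsq : √S * √S = S := Real.mul_self_sqrt hS0
    have hsp : 0 < √S := Real.sqrt_pos.mpr hpos
    have hmem : (∑ I, ∑ J, (z I / √S) * M I J * (z J / √S)) ≤ maxEig M := by
      apply le_csSup hbdd
      refine ⟨fun I => z I / √S, ?_, rfl⟩
      simp only [div_pow]
      rw [← Finset.sum_div, Real.sq_sqrt hS0, ← hS, div_self hpos.ne']
    have heq : (∑ I, ∑ J, (z I / √S) * M I J * (z J / √S)) =
        (∑ I, ∑ J, z I * M I J * z J) / S := by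
      rw [Finset.sum_div]
      refine Finset.sum_congr rfl fun I _ => ?_
      rw [Finset.sum_div]
      refine Finset.sum_congr rfl fun J _ => ?_
      rw [div_mul_eq_mul_div, div_mul_div_comm, hsq]
    rw [heq, div_le_iff₀ hpos] at hmem
    exact hmem

variable {G : Type} [AddCommGroup G] [Fintype G] [DecidableEq G]

/-- The quartic form placed on the variables `ι a`. -/
noncomputable def fpoly {n : ℕ} (D : Finset G) (ι : G → Fin n) : MvPolynomial (Fin n) ℝ :=
  ∑ a, ∑ b, ∑ c, ∑ d, if Quad D a b c d then
    MvPolynomial.X (ι a) * MvPolynomial.X (ι b) * MvPolynomial.X (ι c) * MvPolynomial.X (ι d)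
    else 0

lemma fpoly_eval {n : ℕ} (D : Finset G) (ι : G → Fin n) (x : Fin n → ℝ) :
    MvPolynomial.eval x (fpoly D ι) = quartic D (fun a => x (ι a)) := by
  unfold fpoly quartic
  simp only [map_sum, apply_ite (MvPolynomial.eval x), map_mul, MvPolynomial.eval_X, map_zero]

lemma fpoly_hom {n : ℕ} (D : Finset G) (ι : G → Fin n) : (fpoly D ι).IsHomogeneous 4 := by
  unfold fpoly
  refine MvPolynomial.IsHomogeneous.sum _ _ _ fun a _ => MvPolynomial.IsHomogeneous.sum _ _ _
    fun b _ => MvPolynomial.IsHomogeneous.sum _ _ _ fun c _ =>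
    MvPolynomial.IsHomogeneous.sum _ _ _ fun d _ => ?_
  split_ifs
  · exact (((MvPolynomial.isHomogeneous_X ℝ (ι a)).mul (MvPolynomial.isHomogeneous_X ℝ (ι b))).mul
      (MvPolynomial.isHomogeneous_X ℝ (ι c))).mul (MvPolynomial.isHomogeneous_X ℝ (ι d))
  · exact MvPolynomial.isHomogeneous_zero _ _ _

lemma fpoly_coeff {n : ℕ} (D : Finset G) (ι : G → Fin n) (m : Fin n →₀ ℕ) :
    0 ≤ MvPolynomial.coeff m (fpoly D ι) := by
  unfold fpoly
  simp only [MvPolynomial.coeff_sum]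
  refine Finset.sum_nonneg fun a _ => Finset.sum_nonneg fun b _ => Finset.sum_nonneg fun c _ =>
    Finset.sum_nonneg fun d _ => ?_
  split_ifs
  · have h : (MvPolynomial.X (ι a) * MvPolynomial.X (ι b) * MvPolynomial.X (ι c) *
        MvPolynomial.X (ι d) : MvPolynomial (Fin n) ℝ) =
        MvPolynomial.monomial (Finsupp.single (ι a) 1 + Finsupp.single (ι b) 1 +
          Finsupp.single (ι c) 1 + Finsupp.single (ι d) 1) 1 := by
      simp only [MvPolynomial.X, MvPolynomial.monomial_mul, mul_one]
    rw [h, MvPolynomial.coeff_monomial]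
    split_ifs <;> norm_num
  · simp

lemma quartic_abs (D : Finset G) (x : G → ℝ) : |quartic D x| ≤ quartic D (fun a => |x a|) := by
  unfold quartic
  refine (Finset.abs_sum_le_sum_abs _ _).trans (Finset.sum_le_sum fun a _ => ?_)
  refine (Finset.abs_sum_le_sum_abs _ _).trans (Finset.sum_le_sum fun b _ => ?_)
  refine (Finset.abs_sum_le_sum_abs _ _).trans (Finset.sum_le_sum fun c _ => ?_)
  refine (Finset.abs_sum_le_sum_abs _ _).trans (Finset.sum_le_sum fun d _ => ?_)
  split_ifs
  · simp only [abs_mul]; exact le_rfl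
  · simp

lemma fpoly_norm {n : ℕ} (D : Finset G) (hG : ∀ a : G, a + a = 0) (h0 : 0 ∉ D)
    (hD : FewCommon D) (ι : G → Fin n) (hι : Function.Injective ι) (J : ℕ)
    (hJ : Fintype.card G ≤ 4 ^ J) : sphereNorm (fpoly D ι) ≤ 5776 * ((J : ℝ) + 1) ^ 4 := by
  unfold sphereNorm
  apply Real.sSup_le
  · rintro y ⟨x, hx, rfl⟩
    rw [fpoly_eval]
    refine (quartic_abs D _).trans ?_
    refine quartic_le D hG h0 hD _ (fun a => abs_nonneg _) ?_ J hJ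
    simp only [sq_abs]
    rw [← hx, ← Finset.sum_image (f := fun i => x i ^ 2) (s := Finset.univ) (g := ι)
      (fun a _ b _ h => hι h)]
    exact Finset.sum_le_sum_of_subset_of_nonneg (Finset.subset_univ _)
      (fun _ _ _ => sq_nonneg _)
  · positivity

/-- The index map on pairs. -/
def pairMap {n : ℕ} (ι : G → Fin n) (p : G × G) : Fin 2 → Fin n := ![ι p.1, ι p.2]

lemma pairMap_inj {n : ℕ} {ι : G → Fin n} (hι : Function.Injective ι) :
    Function.Injective (pairMap ι) := by
  rintro ⟨a, b⟩ ⟨c, d⟩ h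
  have h0 := congrFun h 0
  have h1 := congrFun h 1
  simp only [pairMap, Matrix.cons_val_zero, Matrix.cons_val_one] at h0 h1
  rw [hι h0, hι h1]

lemma repr_restrict {n : ℕ} (D : Finset G) (ι : G → Fin n) (hι : Function.Injective ι)
    (M : Matrix (Fin 2 → Fin n) (Fin 2 → Fin n) ℝ) (hM : IsMatrixRepr 2 M (fpoly D ι))
    (x : G → ℝ) :
    ∑ i, ∑ j, M (pairMap ι i) (pairMap ι j) * (x i.1 * x i.2) * (x j.1 * x j.2)
      = quartic D x := by
  have h := hM.2 (Function.extend ι x 0)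
  rw [fpoly_eval] at h
  simp only [hι.extend_apply] at h
  rw [← h]
  have hout : ∀ I : Fin 2 → Fin n, I ∉ Set.range (pairMap ι) →
      ∏ t, Function.extend ι x 0 (I t) = 0 := by
    intro I hI
    by_contra hne
    rw [Fin.prod_univ_two] at hne
    have h0 : ∃ a, ι a = I 0 := by
      by_contra hc
      rw [Function.extend_apply' _ _ _ hc] at hne
      simp at hne
    have h1 : ∃ a, ι a = I 1 := by
      by_contra hc
      rw [Function.extend_apply' _ _ _ hc] at hne
      simp at hne
    obtain ⟨a, ha⟩ := h0
    obtain ⟨b, hb⟩ := h1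
    apply hI
    refine ⟨(a, b), ?_⟩
    ext t
    fin_cases t
    · simp [pairMap, ha]
    · simp [pairMap, hb]
  have hin : ∀ p : G × G, ∏ t, Function.extend ι x 0 (pairMap ι p t) = x p.1 * x p.2 := by
    intro p
    rw [Fin.prod_univ_two]
    simp [pairMap, hι.extend_apply]
  apply Fintype.sum_of_injective (pairMap ι) (pairMap_inj hι)
  · intro I hI
    simp [hout I hI]
  · intro i
    apply Fintype.sum_of_injective (pairMap ι) (pairMap_inj hι)
    · intro J hJ
      simp [hout J hJ]
    · intro j
      rw [hin, hin]

lemma form_restrict {n : ℕ} (ι : G → Fin n) (hι : Function.Injective ι)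
    (M : Matrix (Fin 2 → Fin n) (Fin 2 → Fin n) ℝ) (z : G × G → ℝ) :
    ∑ i, ∑ j, z i * M (pairMap ι i) (pairMap ι j) * z j ≤ maxEig M * ∑ i, z i ^ 2 := by
  have hp := pairMap_inj hι
  have h := quad_form_le M (Function.extend (pairMap ι) z 0)
  have hout : ∀ I : Fin 2 → Fin n, I ∉ Set.range (pairMap ι) →
      Function.extend (pairMap ι) z 0 I = 0 := by
    intro I hI
    rw [Function.extend_apply' _ _ _ (by simpa using hI)]
    rfl
  have e1 : ∑ i, z i ^ 2 = ∑ I, Function.extend (pairMap ι) z 0 I ^ 2 := by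
    apply Fintype.sum_of_injective (pairMap ι) hp
    · intro I hI
      simp [hout I hI]
    · intro i
      rw [hp.extend_apply]
  have e2 : ∑ i, ∑ j, z i * M (pairMap ι i) (pairMap ι j) * z j =
      ∑ I, ∑ J, Function.extend (pairMap ι) z 0 I * M I J *
        Function.extend (pairMap ι) z 0 J := by
    apply Fintype.sum_of_injective (pairMap ι) hp
    · intro I hI
      simp [hout I hI]
    · intro i
      apply Fintype.sum_of_injective (pairMap ι) hp
      · intro J hJ
        simp [hout J hJ]
      · intro j
        rw [hp.extend_apply, hp.extend_apply]
  rw [e1, e2]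
  exact h

lemma exists_odd_exp (n : ℕ) (hn : 8 ^ 4 ≤ n) :
    ∃ k : ℕ, Odd k ∧ 3 ≤ k ∧ 8 ^ k ≤ n ∧ n < 64 * 8 ^ k := by
  have h1 : 8 ^ Nat.log 8 n ≤ n := Nat.pow_log_le_self 8 (by omega)
  have h2 : n < 8 ^ (Nat.log 8 n + 1) := Nat.lt_pow_succ_log_self (by norm_num) n
  have h3 : 4 ≤ Nat.log 8 n := (Nat.le_log_iff_pow_le (by norm_num) (by omega)).mpr hn
  generalize Nat.log 8 n = m at *
  rcases Nat.even_or_odd m with hm | hm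
  · obtain ⟨t, rfl⟩ : ∃ t, m = t + 1 := ⟨m - 1, by omega⟩
    refine ⟨t, ?_, by omega, ?_, ?_⟩
    · rcases Nat.even_or_odd t with ht | ht
      · exfalso
        rw [Nat.even_add_one] at hm
        exact hm ht
      · exact ht
    · refine le_trans ?_ h1
      exact Nat.pow_le_pow_right (by norm_num) (by omega)
    · refine lt_of_lt_of_eq h2 ?_
      ring
  · refine ⟨m, hm, by omega, h1, ?_⟩
    rw [pow_succ] at h2
    omega

end Assembly

end Helpers

theorem stmt17 : ∃ c C : ℝ, 0 < c ∧ 0 < C ∧ ∃ N : ℕ, ∀ n : ℕ, N ≤ n →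
    ∃ f : MvPolynomial (Fin n) ℝ,
      f.IsHomogeneous 4 ∧ (∀ m, 0 ≤ coeff m f) ∧
      sphereNorm f ≤ Real.log n ^ (C : ℝ) ∧
      ∀ M : Matrix (Fin 2 → Fin n) (Fin 2 → Fin n) ℝ, IsMatrixRepr 2 M f →
        c * (n : ℝ) ^ ((1 : ℝ) / 6) / Real.log n ^ 2 ≤ maxEig M := by
  refine ⟨1 / 80, 5, by norm_num, by norm_num, ?_⟩
  rw [← Filter.eventually_atTop (p := fun n : ℕ => ∃ f : MvPolynomial (Fin n) ℝ,
      f.IsHomogeneous 4 ∧ (∀ m, 0 ≤ coeff m f) ∧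
      sphereNorm f ≤ Real.log n ^ ((5 : ℝ) : ℝ) ∧
      ∀ M : Matrix (Fin 2 → Fin n) (Fin 2 → Fin n) ℝ, IsMatrixRepr 2 M f →
        1 / 80 * (n : ℝ) ^ ((1 : ℝ) / 6) / Real.log n ^ 2 ≤ maxEig M)]
  filter_upwards [(Real.tendsto_log_atTop.comp
    tendsto_natCast_atTop_atTop).eventually_ge_atTop (92416 : ℝ),
    Filter.eventually_ge_atTop (8 ^ 4)] with n hlog hn
  simp only [Function.comp_apply] at hlog
  obtain ⟨k, hodd, hk3, hkn, hnk⟩ := exists_odd_exp n hn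
  obtain ⟨G, _, _, _, D, hG, h0, hcard, hDpos, hFew, hSpec, hr⟩ := exists_config k hodd
  have hq3 : (2 ^ k) ^ 3 = 8 ^ k := by rw [← pow_mul, mul_comm, pow_mul]; norm_num
  have hle : Fintype.card G ≤ Fintype.card (Fin n) := by
    rw [Fintype.card_fin, hcard, hq3]; exact hkn
  obtain ⟨ι⟩ := Function.Embedding.nonempty_of_card_le hle
  set L := Real.log n with hL
  refine ⟨fpoly D ι, fpoly_hom D ι, fpoly_coeff D ι, ?_, ?_⟩
  · have hJ : Fintype.card G ≤ 4 ^ (2 * k) := by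
      rw [hcard, ← pow_mul, pow_mul 4 2 k, show (4 ^ 2 : ℕ) = 2 ^ 4 by norm_num, ← pow_mul]
      exact Nat.pow_le_pow_right (by norm_num) (by omega)
    have h1 := fpoly_norm D hG h0 hFew ι ι.injective (2 * k) hJ
    have hkL : (3 / 2 : ℝ) * k ≤ L := by
      have e1 : Real.log ((8 : ℝ) ^ k) ≤ L := by
        apply Real.log_le_log (by positivity)
        exact_mod_cast hkn
      rw [Real.log_pow, show (8 : ℝ) = 2 ^ 3 by norm_num, Real.log_pow] at e1
      have e2 := Real.log_two_gt_d9
      have e3 : (0 : ℝ) ≤ k := Nat.cast_nonneg k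
      push_cast at e1
      nlinarith
    have hk3' : (3 : ℝ) ≤ k := by exact_mod_cast hk3
    have h2 : (((2 * k : ℕ) : ℝ) + 1) ≤ 2 * L := by push_cast; linarith
    have h3 : (((2 * k : ℕ) : ℝ) + 1) ^ 4 ≤ (2 * L) ^ 4 :=
      pow_le_pow_left₀ (by positivity) h2 4
    have h5 : L ^ (5 : ℝ) = L ^ 5 := by
      rw [← Real.rpow_natCast]; norm_num
    rw [h5]
    have h6 : 92416 * L ^ 4 ≤ L * L ^ 4 := mul_le_mul_of_nonneg_right hlog (by positivity)
    calc sphereNorm (fpoly D ι) ≤ 5776 * (((2 * k : ℕ) : ℝ) + 1) ^ 4 := h1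
      _ ≤ 5776 * (2 * L) ^ 4 := by linarith
      _ = 92416 * L ^ 4 := by ring
      _ ≤ L * L ^ 4 := h6
      _ = L ^ 5 := by ring
  · intro M hM
    set s := √(2 ^ k : ℝ) with hs
    have hss : s ^ 2 = 2 ^ k := Real.sq_sqrt (by positivity)
    have hs0 : 0 ≤ s := Real.sqrt_nonneg _
    have h := dual_bound D hG h0 (4 * s + 2) (by positivity) hSpec ((2 ^ k : ℝ) - 2) hr
      (fun p r => M (pairMap ι p) (pairMap ι r))
      (repr_restrict D ι ι.injective M hM) (maxEig M) (form_restrict ι ι.injective M)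
    have hpos : (0 : ℝ) < Fintype.card G * D.card := by
      rw [hcard]
      have : (0 : ℝ) < D.card := by exact_mod_cast hDpos
      push_cast
      positivity
    have h1 : (2 ^ k : ℝ) - 2 ≤ maxEig M * (2 * (4 * s + 2)) := by
      refine le_of_mul_le_mul_left ?_ hpos
      linarith
    have hs2 : 2 ≤ s := by
      rw [hs]
      apply Real.le_sqrt_of_sq_le
      exact pow_le_pow_right₀ (by norm_num) (by omega)
    have h2 : s / 40 ≤ maxEig M := by
      rw [← hss] at h1
      have hp : (0 : ℝ) < 2 * (4 * s + 2) := by linarith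
      refine le_of_mul_le_mul_right ?_ hp
      nlinarith
    have hn6 : (n : ℝ) ^ ((1 : ℝ) / 6) ≤ 2 * s := by
      have e1 : (n : ℝ) ≤ (2 * s) ^ 6 := by
        have e2 : (n : ℝ) ≤ 64 * 8 ^ k := by exact_mod_cast hnk.le
        have e3 : (2 * s) ^ 6 = 64 * (s ^ 2) ^ 3 := by ring
        have e4 : ((2 : ℝ) ^ k) ^ 3 = 8 ^ k := by exact_mod_cast hq3
        rw [e3, hss, e4]
        exact e2
      calc (n : ℝ) ^ ((1 : ℝ) / 6) ≤ ((2 * s) ^ 6) ^ ((1 : ℝ) / 6) :=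
            Real.rpow_le_rpow (Nat.cast_nonneg n) e1 (by norm_num)
        _ = 2 * s := by
            rw [← Real.rpow_natCast, ← Real.rpow_mul (by positivity)]
            norm_num
    have hL2 : 1 ≤ L ^ 2 := one_le_pow₀ (by linarith)
    calc 1 / 80 * (n : ℝ) ^ ((1 : ℝ) / 6) / L ^ 2 ≤ 1 / 80 * (n : ℝ) ^ ((1 : ℝ) / 6) :=
          div_le_self (by positivity) hL2
      _ ≤ s / 40 := by linarith
      _ ≤ maxEig M := h2
end

section
/- Let M be an SoS-symmetric real matrix with rows and columns indexed by [n]², let T be the 4-tensor T[i₁,i₂,i₃,i₄] := M[(i₁,i₂),(i₃,i₄)], and for nonnegative integers x + y = 4 let M_{x,y} be the [n]^x × [n]^y matrix with M_{x,y}[(i₁,…,i_x),(j₁,…,j_y)] := T[i₁,…,i_x,j₁,…,j_y]. Suppose that M is positive semidefinite, that M_{3,1} ⊗ M_{0,4} ⊗ M_{3,1} is positive semidefinite, and that M_{3,1} ⊗ M_{1,3} is positive semidefinite. Then for every positive integer q divisible by 4, the symmetrization (M^{⊗ q/4})^S is positive semidefinite. -/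
/-- `M^{⊗r}`, the `r`-fold Kronecker power of a matrix `M` indexed by `[n]²`,
regarded as a matrix with rows and columns indexed by tuples in `[n]^{2r}`. -/
def kronPow {n : ℕ} (M : Matrix (Fin n × Fin n) (Fin n × Fin n) ℝ) (r : ℕ) :
    Matrix (Fin (2 * r) → Fin n) (Fin (2 * r) → Fin n) ℝ :=
  Matrix.of fun I J =>
    ∏ g : Fin r,
      M (I ⟨2 * g.1, by have := g.2; omega⟩, I ⟨2 * g.1 + 1, by have := g.2; omega⟩)
        (J ⟨2 * g.1, by have := g.2; omega⟩, J ⟨2 * g.1 + 1, by have := g.2; omega⟩)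

/-- `B^π` for a permutation `π` of `[q] = [q/2] ⊕ [q/2]`:
`B^π[(k₁,…,k_{q/2}),(k_{q/2+1},…,k_q)] = B[(k_{π(1)},…,k_{π(q/2)}),(k_{π(q/2+1)},…,k_{π(q)})]`. -/
def permMat {n m : ℕ} (B : Matrix (Fin m → Fin n) (Fin m → Fin n) ℝ)
    (π : Equiv.Perm (Fin m ⊕ Fin m)) :
    Matrix (Fin m → Fin n) (Fin m → Fin n) ℝ :=
  Matrix.of fun I J =>
    B (fun t => Sum.elim I J (π (Sum.inl t))) (fun t => Sum.elim I J (π (Sum.inr t)))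

/-- The symmetrization `B^S = (1/q!) Σ_{π ∈ S_q} B^π`. -/
noncomputable def symMat {n m : ℕ} (B : Matrix (Fin m → Fin n) (Fin m → Fin n) ℝ) :
    Matrix (Fin m → Fin n) (Fin m → Fin n) ℝ :=
  (((2 * m).factorial : ℝ))⁻¹ • ∑ π : Equiv.Perm (Fin m ⊕ Fin m), permMat B π

/-! ### Combinatorics: splitting off a balanced group -/

theorem exists_pos_of_sum {X : Type*} (w : X → ℤ) (B : Multiset X) (h : 0 < (B.map w).sum) :
    ∃ x ∈ B, 0 < w x := by
  by_contra! hc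
  have : (B.map w).sum ≤ 0 := by
    clear h
    induction B using Multiset.induction with
    | empty => simp
    | cons a B ih =>
      have h1 := ih (fun x hx => hc x (Multiset.mem_cons_of_mem hx))
      have h2 := hc a (Multiset.mem_cons_self a B)
      rw [Multiset.map_cons, Multiset.sum_cons]
      omega
  omega

theorem sum_neg_weight {X : Type*} (w : X → ℤ) (B : Multiset X) :
    (B.map fun x => - w x).sum = - (B.map w).sum := by
  induction B using Multiset.induction with
  | empty => simp
  | cons a B ih => simp only [Multiset.map_cons, Multiset.sum_cons, ih]; ring

theorem exists_neg_of_sum {X : Type*} (w : X → ℤ) (B : Multiset X) (h : (B.map w).sum < 0) :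
    ∃ x ∈ B, w x < 0 := by
  obtain ⟨x, hx, h⟩ := exists_pos_of_sum (fun x => - w x) B (by
    rw [sum_neg_weight]; omega)
  exact ⟨x, hx, by omega⟩

/-- Removable groups, in terms of weights. -/
def GroupW {X : Type*} (w : X → ℤ) (G : Multiset X) : Prop :=
  (∃ x, G = {x} ∧ w x = 0) ∨
  (∃ x y, G = {x, y} ∧ w x = 4 ∧ w y = -4) ∨
  (∃ x y, G = {x, y} ∧ w x = 2 ∧ w y = -2) ∨
  (∃ x y z, G = {x, y, z} ∧ w x = 2 ∧ w y = 2 ∧ w z = -4) ∨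
  (∃ x y z, G = {x, y, z} ∧ w x = -2 ∧ w y = -2 ∧ w z = 4)

theorem GroupW.neg {X : Type*} {w : X → ℤ} {G : Multiset X} (h : GroupW (fun x => - w x) G) :
    GroupW w G := by
  rcases h with ⟨x, hG, h⟩ | ⟨x, y, hG, h1, h2⟩ | ⟨x, y, hG, h1, h2⟩ |
    ⟨x, y, z, hG, h1, h2, h3⟩ | ⟨x, y, z, hG, h1, h2, h3⟩ <;> beta_reduce at *
  · exact Or.inl ⟨x, hG, by omega⟩
  · exact Or.inr (Or.inl ⟨y, x, by rw [hG, Multiset.pair_comm], by omega, by omega⟩)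
  · exact Or.inr (Or.inr (Or.inl ⟨y, x, by rw [hG, Multiset.pair_comm], by omega, by omega⟩))
  · exact Or.inr (Or.inr (Or.inr (Or.inr ⟨x, y, z, hG, by omega, by omega, by omega⟩)))
  · exact Or.inr (Or.inr (Or.inr (Or.inl ⟨x, y, z, hG, by omega, by omega, by omega⟩)))

theorem exists_group_pos {X : Type*} (w : X → ℤ) (B : Multiset X)
    (hw : ∀ x ∈ B, w x = -4 ∨ w x = -2 ∨ w x = 0 ∨ w x = 2 ∨ w x = 4)
    (hs : (B.map w).sum = 0) (x : X) (hx : x ∈ B) (hpos : 0 ≤ w x) :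
    ∃ G S, B = G + S ∧ GroupW w G := by
  obtain ⟨B, rfl⟩ := Multiset.exists_cons_of_mem hx
  by_cases h0 : w x = 0
  · exact ⟨{x}, B, by simp, Or.inl ⟨x, rfl, h0⟩⟩
  simp only [Multiset.map_cons, Multiset.sum_cons, Multiset.mem_cons, forall_eq_or_imp] at hs hw
  obtain ⟨y, hy, hyn⟩ := exists_neg_of_sum w B (by omega)
  obtain ⟨B, rfl⟩ := Multiset.exists_cons_of_mem hy
  simp only [Multiset.map_cons, Multiset.sum_cons, Multiset.mem_cons, forall_eq_or_imp] at hs hw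
  by_cases h1 : w x + w y = 0
  · refine ⟨{x, y}, B, by simp, ?_⟩
    by_cases h2 : w x = 4
    · exact Or.inr (Or.inl ⟨x, y, rfl, h2, by omega⟩)
    · exact Or.inr (Or.inr (Or.inl ⟨x, y, rfl, by omega, by omega⟩))
  by_cases h2 : w x = 4
  · obtain ⟨z, hz, hzn⟩ := exists_neg_of_sum w B (by omega)
    obtain ⟨B, rfl⟩ := Multiset.exists_cons_of_mem hz
    simp only [Multiset.mem_cons, forall_eq_or_imp] at hw
    by_cases h3 : w z = -4
    · refine ⟨{x, z}, y ::ₘ B, ?_, Or.inr (Or.inl ⟨x, z, rfl, h2, h3⟩)⟩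
      simp [Multiset.cons_swap]
    · refine ⟨{y, z, x}, B, ?_, Or.inr (Or.inr (Or.inr (Or.inr
        ⟨y, z, x, rfl, by omega, by omega, h2⟩)))⟩
      simp only [Multiset.insert_eq_cons, Multiset.cons_add, Multiset.singleton_add]
      rw [Multiset.cons_swap x y, Multiset.cons_swap x z]
  · obtain ⟨z, hz, hzn⟩ := exists_pos_of_sum w B (by omega)
    obtain ⟨B, rfl⟩ := Multiset.exists_cons_of_mem hz
    simp only [Multiset.mem_cons, forall_eq_or_imp] at hw
    by_cases h3 : w z = 4
    · refine ⟨{z, y}, x ::ₘ B, ?_, Or.inr (Or.inl ⟨z, y, rfl, h3, by omega⟩)⟩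
      simp only [Multiset.insert_eq_cons, Multiset.cons_add, Multiset.singleton_add]
      rw [Multiset.cons_swap y z, Multiset.cons_swap x z, Multiset.cons_swap x y]
    · refine ⟨{x, z, y}, B, ?_, Or.inr (Or.inr (Or.inr (Or.inl
        ⟨x, z, y, rfl, by omega, by omega, by omega⟩)))⟩
      simp only [Multiset.insert_eq_cons, Multiset.cons_add, Multiset.singleton_add]
      rw [Multiset.cons_swap y z]

theorem exists_group {X : Type*} (w : X → ℤ) (B : Multiset X)
    (hw : ∀ x ∈ B, w x = -4 ∨ w x = -2 ∨ w x = 0 ∨ w x = 2 ∨ w x = 4)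
    (hs : (B.map w).sum = 0) (hB : B ≠ 0) :
    ∃ G S, B = G + S ∧ GroupW w G := by
  obtain ⟨x, hx⟩ := Multiset.exists_mem_of_ne_zero hB
  rcases le_total 0 (w x) with h | h
  · exact exists_group_pos w B hw hs x hx h
  · obtain ⟨G, S, h1, h2⟩ := exists_group_pos (fun x => - w x) B
      (fun x hx => by have := hw x hx; omega) (by rw [sum_neg_weight]; omega) x hx (by omega)
    exact ⟨G, S, h1, h2.neg⟩

theorem GroupW.ne_zero {X : Type*} {w : X → ℤ} {G : Multiset X} (h : GroupW w G) : G ≠ 0 := by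
  rcases h with ⟨x, rfl, h⟩ | ⟨x, y, rfl, h1, h2⟩ | ⟨x, y, rfl, h1, h2⟩ |
    ⟨x, y, z, rfl, h1, h2, h3⟩ | ⟨x, y, z, rfl, h1, h2, h3⟩ <;> simp

theorem GroupW.sum {X : Type*} {w : X → ℤ} {G : Multiset X} (h : GroupW w G) :
    (G.map w).sum = 0 := by
  rcases h with ⟨x, rfl, h⟩ | ⟨x, y, rfl, h1, h2⟩ | ⟨x, y, rfl, h1, h2⟩ |
    ⟨x, y, z, rfl, h1, h2, h3⟩ | ⟨x, y, z, rfl, h1, h2, h3⟩ <;> simp [*]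

/-! ### Alignment of rows and columns -/

/-- The product of block values. A block is a pair (row positions, column positions). -/
def blockProd {α V : Type*} (T : Multiset V → ℝ) (B : Multiset (Multiset α × Multiset α))
    (I J : α → V) : ℝ :=
  (B.map fun b => T (b.1.map I + b.2.map J)).prod

theorem blockProd_congr {α V : Type*} (T : Multiset V → ℝ)
    (B : Multiset (Multiset α × Multiset α)) (I J J' : α → V)
    (h : ∀ x ∈ (B.map Prod.snd).sum, J x = J' x) :
    blockProd T B I J = blockProd T B I J' := by
  unfold blockProd
  congr 1
  apply Multiset.map_congr rfl
  intro b hb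
  congr 2
  apply Multiset.map_congr rfl
  intro x hx
  apply h
  obtain ⟨B, rfl⟩ := Multiset.exists_cons_of_mem hb
  simp [hx]

/-- `B` admits a matching `e` of columns with rows making the matrix PSD. -/
def Matched {α V : Type*} (T : Multiset V → ℝ) (B : Multiset (Multiset α × Multiset α)) : Prop :=
  ∃ e : α → α, ((B.map Prod.snd).sum).map e = (B.map Prod.fst).sum ∧
    Matrix.PosSemidef (Matrix.of fun I J : α → V => blockProd T B I (J ∘ e))

theorem Matched.add {α V : Type*} [Finite α] [Finite V] (T : Multiset V → ℝ)
    (G S : Multiset (Multiset α × Multiset α))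
    (hd : ((G + S).map Prod.snd).sum.Nodup) (hG : Matched T G) (hS : Matched T S) :
    Matched T (G + S) := by
  classical
  obtain ⟨e, he, hep⟩ := hG
  obtain ⟨f, hf, hfp⟩ := hS
  simp only [Multiset.map_add, Multiset.sum_add] at hd
  have hdis := (Multiset.nodup_add.1 hd).2.2
  let k : α → α := fun x => if x ∈ (G.map Prod.snd).sum then e x else f x
  have hk1 : ∀ x ∈ (G.map Prod.snd).sum, k x = e x := fun x hx => if_pos hx
  have hk2 : ∀ x ∈ (S.map Prod.snd).sum, k x = f x := fun x hx =>
    if_neg (fun h => Multiset.disjoint_left.1 hdis h hx)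
  refine ⟨k, ?_, ?_⟩
  · simp only [Multiset.map_add, Multiset.sum_add]
    rw [Multiset.map_congr rfl hk1, Multiset.map_congr rfl hk2, he, hf]
  · cases nonempty_fintype α
    cases nonempty_fintype V
    have := hep.hadamard hfp
    refine Eq.mp (congrArg Matrix.PosSemidef ?_) this
    ext I J
    simp only [Matrix.of_apply, Matrix.hadamard_apply]
    rw [← blockProd_congr T G I (J ∘ k) (J ∘ e) (fun x hx => by simp [hk1 x hx]),
      ← blockProd_congr T S I (J ∘ k) (J ∘ f) (fun x hx => by simp [hk2 x hx])]
    simp [blockProd]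

theorem matched_zero {α V : Type*} [Finite α] [Finite V] (T : Multiset V → ℝ) :
    Matched (α := α) T 0 := by
  refine ⟨id, by simp, ?_⟩
  cases nonempty_fintype α
  cases nonempty_fintype V
  classical
  convert Matrix.posSemidef_vecMulVec_self_star (R := ℝ) (fun _ : α → V => 1) using 1
  ext I J
  simp [blockProd, Matrix.vecMulVec_apply]

theorem matched_of_aligned {α V : Type*} [Finite α] [Finite V] (T : Multiset V → ℝ)
    (G : Multiset (Multiset α × Multiset α)) (hd : (G.map Prod.snd).sum.Nodup)
    (k : ℕ) (Q : Matrix (Fin k → V) (Fin k → V) ℝ) (hQ : Q.PosSemidef) (a c : Fin k → α)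
    (ha : (G.map Prod.fst).sum = (List.ofFn a : Multiset α))
    (hc : (G.map Prod.snd).sum = (List.ofFn c : Multiset α))
    (h : ∀ I J, blockProd T G I J = Q (I ∘ a) (J ∘ c)) : Matched T G := by
  have hci : Function.Injective c := by
    rw [hc, Multiset.coe_nodup] at hd
    exact List.nodup_ofFn.1 hd
  have hex : Function.extend c a id ∘ c = a := by
    ext x; simp [hci.extend_apply]
  refine ⟨Function.extend c a id, ?_, ?_⟩
  · rw [hc, ha, Multiset.map_coe, List.map_ofFn, hex]
  · convert hQ.submatrix (fun I : α → V => I ∘ a) using 1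
    ext I J
    simp only [Matrix.of_apply, h, Matrix.submatrix_apply, Function.comp_assoc, hex]

theorem multiset_card_four {α : Type*} {s : Multiset α} (h : s.card = 4) :
    ∃ a b c d, s = {a, b, c, d} := by
  obtain ⟨a, t, ht, rfl⟩ : ∃ a t, t.card = 3 ∧ s = a ::ₘ t := by
    obtain ⟨a, ha⟩ := Multiset.card_pos_iff_exists_mem.1 (by omega : 0 < s.card)
    obtain ⟨t, rfl⟩ := Multiset.exists_cons_of_mem ha
    exact ⟨a, t, by simpa using h, rfl⟩
  obtain ⟨b, c, d, rfl⟩ := Multiset.card_eq_three.1 ht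
  exact ⟨a, b, c, d, rfl⟩

/-- The weight of a block. -/
def blockW {α : Type*} (b : Multiset α × Multiset α) : ℤ := (b.1.card : ℤ) - b.2.card

theorem block_four {α : Type*} {x : Multiset α × Multiset α} (h4 : x.1.card + x.2.card = 4)
    (h : blockW x = 4) : ∃ a b c d, x = ({a, b, c, d}, 0) := by
  obtain ⟨R, C⟩ := x
  simp only [blockW] at h h4
  obtain ⟨a, b, c, d, rfl⟩ := multiset_card_four (s := R) (by omega)
  have hC : C.card = 0 := by omega
  rw [Multiset.card_eq_zero] at hC
  exact ⟨a, b, c, d, by rw [hC]⟩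

theorem block_two {α : Type*} {x : Multiset α × Multiset α} (h4 : x.1.card + x.2.card = 4)
    (h : blockW x = 2) : ∃ a b c d, x = ({a, b, c}, {d}) := by
  obtain ⟨R, C⟩ := x
  simp only [blockW] at h h4
  obtain ⟨a, b, c, rfl⟩ := Multiset.card_eq_three.1 (by omega : R.card = 3)
  obtain ⟨d, rfl⟩ := Multiset.card_eq_one.1 (by omega : C.card = 1)
  exact ⟨a, b, c, d, rfl⟩

theorem block_zero {α : Type*} {x : Multiset α × Multiset α} (h4 : x.1.card + x.2.card = 4)
    (h : blockW x = 0) : ∃ a b c d, x = ({a, b}, {c, d}) := by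
  obtain ⟨R, C⟩ := x
  simp only [blockW] at h h4
  obtain ⟨a, b, rfl⟩ := Multiset.card_eq_two.1 (by omega : R.card = 2)
  obtain ⟨c, d, rfl⟩ := Multiset.card_eq_two.1 (by omega : C.card = 2)
  exact ⟨a, b, c, d, rfl⟩

theorem block_neg_two {α : Type*} {x : Multiset α × Multiset α} (h4 : x.1.card + x.2.card = 4)
    (h : blockW x = -2) : ∃ a b c d, x = ({a}, {b, c, d}) := by
  obtain ⟨a, b, c, d, hx⟩ := block_two (x := x.swap) (by simp; omega) (by
    simp only [blockW, Prod.fst_swap, Prod.snd_swap] at h ⊢; omega)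
  exact ⟨d, a, b, c, by rw [← x.swap_swap, hx]; rfl⟩

theorem block_neg_four {α : Type*} {x : Multiset α × Multiset α} (h4 : x.1.card + x.2.card = 4)
    (h : blockW x = -4) : ∃ a b c d, x = (0, {a, b, c, d}) := by
  obtain ⟨a, b, c, d, hx⟩ := block_four (x := x.swap) (by simp; omega) (by
    simp only [blockW, Prod.fst_swap, Prod.snd_swap] at h ⊢; omega)
  exact ⟨a, b, c, d, by rw [← x.swap_swap, hx]; rfl⟩

section groups

variable {n : ℕ} {α : Type*} [Finite α] (M : Matrix (Fin n × Fin n) (Fin n × Fin n) ℝ)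
    (T : Multiset (Fin n) → ℝ)

theorem matched_group
    (hT : ∀ i₁ i₂ i₃ i₄ : Fin n, T {i₁, i₂, i₃, i₄} = M (i₁, i₂) (i₃, i₄))
    (hM : M.PosSemidef)
    (hA : Matrix.PosSemidef (Matrix.of fun I J : Fin 6 → Fin n =>
      M (I 0, I 1) (I 2, J 0) * M (J 1, J 2) (J 3, J 4) * M (I 3, I 4) (I 5, J 5)))
    (hB : Matrix.PosSemidef (Matrix.of fun I J : Fin 4 → Fin n =>
      M (I 0, I 1) (I 2, J 0) * M (I 3, J 1) (J 2, J 3)))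
    (G : Multiset (Multiset α × Multiset α)) (h4 : ∀ b ∈ G, b.1.card + b.2.card = 4)
    (hd : (G.map Prod.snd).sum.Nodup) (hG : GroupW blockW G) : Matched T G := by
  rcases hG with ⟨x, rfl, h⟩ | ⟨x, y, rfl, h1, h2⟩ | ⟨x, y, rfl, h1, h2⟩ |
    ⟨x, y, z, rfl, h1, h2, h3⟩ | ⟨x, y, z, rfl, h1, h2, h3⟩
  · obtain ⟨a, b, c, d, rfl⟩ := block_zero (h4 x (by simp)) h
    refine matched_of_aligned T _ hd 2
      (M.submatrix (fun I : Fin 2 → Fin n => (I 0, I 1)) (fun I : Fin 2 → Fin n => (I 0, I 1)))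
      (hM.submatrix _) ![a, b] ![c, d] (by simp [-Multiset.add_cons]; rfl) (by simp [-Multiset.add_cons]; rfl) ?_
    intro I J
    rw [Matrix.submatrix_apply]
    simp only [Function.comp_apply, Matrix.cons_val]
    rw [← hT]
    simp [blockProd, -Multiset.add_cons]
  · obtain ⟨a, b, c, d, rfl⟩ := block_four (h4 x (by simp)) h1
    obtain ⟨a', b', c', d', rfl⟩ := block_neg_four (h4 y (by simp)) h2
    refine matched_of_aligned T _ hd 4
      (Matrix.vecMulVec (fun I : Fin 4 → Fin n => M (I 0, I 1) (I 2, I 3))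
        (star (fun I : Fin 4 → Fin n => M (I 0, I 1) (I 2, I 3))))
      (Matrix.posSemidef_vecMulVec_self_star _) ![a, b, c, d] ![a', b', c', d']
      (by simp [-Multiset.add_cons]; rfl) (by simp [-Multiset.add_cons]; rfl) ?_
    intro I J
    simp only [Matrix.vecMulVec_apply, star_trivial]
    simp only [Function.comp_apply, Matrix.cons_val]
    rw [← hT, ← hT]
    simp [blockProd, -Multiset.add_cons]
  · obtain ⟨a, b, c, d, rfl⟩ := block_two (h4 x (by simp)) h1
    obtain ⟨a', b', c', d', rfl⟩ := block_neg_two (h4 y (by simp)) h2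
    refine matched_of_aligned T _ hd 4 _ hB ![a, b, c, a'] ![d, b', c', d']
      (by simp [-Multiset.add_cons]; rfl) (by simp [-Multiset.add_cons]; rfl) ?_
    intro I J
    simp only [Matrix.of_apply]
    simp only [Function.comp_apply, Matrix.cons_val]
    rw [← hT, ← hT]
    simp [blockProd, -Multiset.add_cons]
  · obtain ⟨a, b, c, d, rfl⟩ := block_two (h4 x (by simp)) h1
    obtain ⟨a', b', c', d', rfl⟩ := block_two (h4 y (by simp)) h2
    obtain ⟨a₂, b₂, c₂, d₂, rfl⟩ := block_neg_four (h4 z (by simp)) h3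
    refine matched_of_aligned T _ hd 6 _ hA ![a, b, c, a', b', c'] ![d, a₂, b₂, c₂, d₂, d']
      (by simp [-Multiset.add_cons]; rfl) ?_ ?_
    · simp only [Multiset.insert_eq_cons, Multiset.map_cons, Multiset.map_singleton,
        Multiset.sum_cons, Multiset.sum_singleton]
      rw [add_comm ({d'} : Multiset α)]
      rfl
    intro I J
    simp only [Matrix.of_apply]
    simp only [Function.comp_apply, Matrix.cons_val]
    rw [← hT, ← hT, ← hT]
    simp [blockProd, -Multiset.add_cons]
    ring
  · obtain ⟨a, b, c, d, rfl⟩ := block_neg_two (h4 x (by simp)) h1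
    obtain ⟨a', b', c', d', rfl⟩ := block_neg_two (h4 y (by simp)) h2
    obtain ⟨a₂, b₂, c₂, d₂, rfl⟩ := block_four (h4 z (by simp)) h3
    refine matched_of_aligned T _ hd 6 _ hA.transpose ![a, a₂, b₂, c₂, d₂, a']
      ![b, c, d, b', c', d'] ?_ (by simp [-Multiset.add_cons]; rfl) ?_
    · simp only [Multiset.insert_eq_cons, Multiset.map_cons, Multiset.map_singleton,
        Multiset.sum_cons, Multiset.sum_singleton]
      rw [add_comm ({a'} : Multiset α)]
      rfl
    intro I J
    simp only [Matrix.transpose_apply, Matrix.of_apply]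
    simp only [Function.comp_apply, Matrix.cons_val]
    have hp : ∀ i j k l : Fin n, M (i, j) (k, l) = T {l, i, j, k} := by
      intro i j k l
      rw [← hT]
      congr 1
      simp only [Multiset.insert_eq_cons, ← Multiset.singleton_add]
      abel
    rw [hp (J b), hp (J b'), ← hT]
    simp [blockProd, -Multiset.add_cons]
    ring

theorem matched_all
    (hT : ∀ i₁ i₂ i₃ i₄ : Fin n, T {i₁, i₂, i₃, i₄} = M (i₁, i₂) (i₃, i₄))
    (hM : M.PosSemidef)
    (hA : Matrix.PosSemidef (Matrix.of fun I J : Fin 6 → Fin n =>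
      M (I 0, I 1) (I 2, J 0) * M (J 1, J 2) (J 3, J 4) * M (I 3, I 4) (I 5, J 5)))
    (hB : Matrix.PosSemidef (Matrix.of fun I J : Fin 4 → Fin n =>
      M (I 0, I 1) (I 2, J 0) * M (I 3, J 1) (J 2, J 3)))
    (N : ℕ) : ∀ (B : Multiset (Multiset α × Multiset α)), B.card = N →
    (∀ b ∈ B, b.1.card + b.2.card = 4) → (B.map Prod.snd).sum.Nodup →
    (B.map blockW).sum = 0 → Matched T B := by
  induction N using Nat.strong_induction_on with
  | _ N ih =>
  intro B hN h4 hd hs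
  by_cases h0 : B = 0
  · subst h0; exact matched_zero T
  obtain ⟨G, S, rfl, hG⟩ := exists_group blockW B (fun x hx => by
    have := h4 x hx
    unfold blockW
    omega) hs h0
  have hG0 := Multiset.card_pos.2 hG.ne_zero
  have hd' := hd
  have hGs := hG.sum
  simp only [Multiset.map_add, Multiset.sum_add, Multiset.card_add] at hd' hs hN
  rw [Multiset.nodup_add] at hd'
  apply Matched.add T G S hd
  · exact matched_group M T hT hM hA hB G (fun b hb => h4 b (by simp [hb])) hd'.1 hG
  · exact ih S.card (by omega) S rfl (fun b hb => h4 b (by simp [hb])) hd'.2.1 (by omega)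

end groups

/-! ### Block structure of the permuted Kronecker power -/

theorem exists_split {α β : Type*} (s : Multiset (α ⊕ β)) :
    ∃ b : Multiset α × Multiset β, s = b.1.map Sum.inl + b.2.map Sum.inr := by
  induction s using Multiset.induction with
  | empty => exact ⟨0, by simp⟩
  | cons a s ih =>
    obtain ⟨b, rfl⟩ := ih
    rcases a with a | a
    · exact ⟨(a ::ₘ b.1, b.2), by simp⟩
    · exact ⟨(b.1, a ::ₘ b.2), by simp⟩

theorem exists_T {n : ℕ} (M : Matrix (Fin n × Fin n) (Fin n × Fin n) ℝ)
    (hsym : ∀ i₁ i₂ i₃ i₄ j₁ j₂ j₃ j₄ : Fin n,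
      ({i₁, i₂, i₃, i₄} : Multiset (Fin n)) = {j₁, j₂, j₃, j₄} →
      M (i₁, i₂) (i₃, i₄) = M (j₁, j₂) (j₃, j₄)) :
    ∃ T : Multiset (Fin n) → ℝ,
      ∀ i₁ i₂ i₃ i₄ : Fin n, T {i₁, i₂, i₃, i₄} = M (i₁, i₂) (i₃, i₄) := by
  classical
  have : ∀ s : Multiset (Fin n), ∃ t : ℝ, ∀ i₁ i₂ i₃ i₄ : Fin n, s = {i₁, i₂, i₃, i₄} →
      t = M (i₁, i₂) (i₃, i₄) := by
    intro s
    by_cases h : ∃ i₁ i₂ i₃ i₄ : Fin n, s = {i₁, i₂, i₃, i₄}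
    · obtain ⟨j₁, j₂, j₃, j₄, rfl⟩ := h
      exact ⟨_, fun i₁ i₂ i₃ i₄ h => hsym _ _ _ _ _ _ _ _ h⟩
    · exact ⟨0, fun i₁ i₂ i₃ i₄ h' => absurd ⟨_, _, _, _, h'⟩ h⟩
  choose T hT using this
  exact ⟨T, fun i₁ i₂ i₃ i₄ => hT _ _ _ _ _ rfl⟩

/-- Each `B^π` becomes PSD after a suitable permutation of the column positions. -/
theorem permMat_matched (n : ℕ) (M : Matrix (Fin n × Fin n) (Fin n × Fin n) ℝ)
    (hsym : ∀ i₁ i₂ i₃ i₄ j₁ j₂ j₃ j₄ : Fin n,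
      ({i₁, i₂, i₃, i₄} : Multiset (Fin n)) = {j₁, j₂, j₃, j₄} →
      M (i₁, i₂) (i₃, i₄) = M (j₁, j₂) (j₃, j₄))
    (hM : M.PosSemidef)
    (hA : Matrix.PosSemidef (Matrix.of fun I J : Fin 6 → Fin n =>
      M (I 0, I 1) (I 2, J 0) * M (J 1, J 2) (J 3, J 4) * M (I 3, I 4) (I 5, J 5)))
    (hB : Matrix.PosSemidef (Matrix.of fun I J : Fin 4 → Fin n =>
      M (I 0, I 1) (I 2, J 0) * M (I 3, J 1) (J 2, J 3)))
    (r : ℕ) (π : Equiv.Perm (Fin (2 * r) ⊕ Fin (2 * r))) :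
    ∃ e : Equiv.Perm (Fin (2 * r)), Matrix.PosSemidef
      (Matrix.of fun I J => permMat (kronPow M r) π I (J ∘ e)) := by
  classical
  obtain ⟨T, hT⟩ := exists_T M hsym
  let p : Fin r → Fin (2 * r) := fun g => ⟨2 * g.1, by have := g.2; omega⟩
  let p' : Fin r → Fin (2 * r) := fun g => ⟨2 * g.1 + 1, by have := g.2; omega⟩
  let W : Fin r → Multiset (Fin (2 * r) ⊕ Fin (2 * r)) := fun g =>
    {π (Sum.inl (p g)), π (Sum.inl (p' g)), π (Sum.inr (p g)), π (Sum.inr (p' g))}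
  choose b hb using fun g => exists_split (W g)
  have hp : ∀ t : Fin (2 * r), ∃ g, t = p g ∨ t = p' g := by
    intro t
    refine ⟨⟨t.1 / 2, by have := t.2; omega⟩, ?_⟩
    rcases Nat.mod_two_eq_zero_or_one t.1 with h | h
    · left; apply Fin.ext; simp only [p]; omega
    · right; apply Fin.ext; simp only [p']; omega
  have hW : (Finset.univ : Finset (Fin (2 * r) ⊕ Fin (2 * r))).val = ∑ g, W g := by
    apply Multiset.eq_of_le_of_card_le
    · rw [Multiset.le_iff_subset Finset.univ.nodup]
      intro x _
      rw [Multiset.mem_sum]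
      obtain ⟨y, rfl⟩ := π.surjective x
      rcases y with t | t <;> obtain ⟨g, rfl | rfl⟩ := hp t <;>
        exact ⟨g, Finset.mem_univ _, by simp [W]⟩
    · simp [W, Multiset.card_sum]
      omega
  have hsplit : ∑ g, W g = (∑ g, (b g).1).map Sum.inl + (∑ g, (b g).2).map Sum.inr := by
    simp_rw [hb, Finset.sum_add_distrib]
    congr 1
    · exact (map_sum (Multiset.mapAddMonoidHom Sum.inl) _ _).symm
    · exact (map_sum (Multiset.mapAddMonoidHom Sum.inr) _ _).symm
  have hnd := (Finset.univ : Finset (Fin (2 * r) ⊕ Fin (2 * r))).nodup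
  rw [hW, hsplit, Multiset.nodup_add] at hnd
  have hn1 := hnd.1.of_map
  have hn2 := hnd.2.1.of_map
  have hmem : ∀ x : Fin (2 * r) ⊕ Fin (2 * r),
      x ∈ (∑ g, (b g).1).map Sum.inl + (∑ g, (b g).2).map Sum.inr := by
    intro x; rw [← hsplit, ← hW]; simp
  have hm1 : ∀ t, t ∈ ∑ g, (b g).1 := fun t => by
    have := hmem (Sum.inl t)
    simpa using this
  have hm2 : ∀ t, t ∈ ∑ g, (b g).2 := fun t => by
    have := hmem (Sum.inr t)
    simpa using this
  have hu1 : ∑ g, (b g).1 = Finset.univ.val :=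
    (Multiset.Nodup.ext hn1 Finset.univ.nodup).2 (fun t => by simp [hm1])
  have hu2 : ∑ g, (b g).2 = Finset.univ.val :=
    (Multiset.Nodup.ext hn2 Finset.univ.nodup).2 (fun t => by simp [hm2])
  let B : Multiset (Multiset (Fin (2 * r)) × Multiset (Fin (2 * r))) := Finset.univ.val.map b
  have hB1 : (B.map Prod.fst).sum = Finset.univ.val := by
    rw [← hu1]; simp only [B, Multiset.map_map]; rfl
  have hB2 : (B.map Prod.snd).sum = Finset.univ.val := by
    rw [← hu2]; simp only [B, Multiset.map_map]; rfl
  have hBw : (B.map blockW).sum = 0 := by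
    have h1 := congrArg Multiset.card (hu1.trans hu2.symm)
    simp only [Multiset.card_sum] at h1
    have h2 : (B.map blockW).sum = ∑ g, (((b g).1.card : ℤ) - (b g).2.card) := by
      simp only [B, Multiset.map_map]; rfl
    rw [h2, Finset.sum_sub_distrib]
    have h3 : ((∑ g, (b g).1.card : ℕ) : ℤ) = ((∑ g, (b g).2.card : ℕ) : ℤ) := by rw [h1]
    push_cast at h3
    omega
  obtain ⟨e, he, hpsd⟩ := matched_all M T hT hM hA hB B.card B rfl (by
    intro x hx
    obtain ⟨g, -, rfl⟩ := Multiset.mem_map.1 hx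
    have := congrArg Multiset.card (hb g)
    simp [W] at this
    omega) (by rw [hB2]; exact Finset.univ.nodup) hBw
  rw [hB1, hB2] at he
  have hes : Function.Surjective e := by
    intro t
    have : t ∈ Multiset.map e Finset.univ.val := by rw [he]; simp
    obtain ⟨s, -, hs⟩ := Multiset.mem_map.1 this
    exact ⟨s, hs⟩
  refine ⟨Equiv.ofBijective e (Finite.surjective_iff_bijective.1 hes), ?_⟩
  refine Eq.mp (congrArg Matrix.PosSemidef ?_) hpsd
  ext I J
  simp only [Matrix.of_apply, permMat, kronPow, Equiv.coe_ofBijective]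
  simp only [blockProd, B, Multiset.map_map]
  change ∏ g, _ = ∏ g, _
  apply Finset.prod_congr rfl
  intro g _
  simp only [Function.comp_apply]
  rw [← hT]
  congr 1
  have := congrArg (Multiset.map (Sum.elim I (J ∘ e))) (hb g)
  simp only [Multiset.map_add, Multiset.map_map] at this
  change _ = Multiset.map I (b g).1 + Multiset.map (J ∘ e) (b g).2 at this
  exact this.symm.trans (by simp [W, p, p'])

/-! ### Symmetrization -/

theorem quad_expand {ι : Type*} [Fintype ι] (A : Matrix ι ι ℝ) (x : ι → ℝ) :
    star x ⬝ᵥ (A.mulVec x) = ∑ i, ∑ j, x i * A i j * x j := by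
  simp [dotProduct, Matrix.mulVec, Finset.mul_sum, mul_assoc]

/-- Precomposition by a permutation, as a permutation of tuples. -/
def preEquiv {m n : ℕ} (e : Equiv.Perm (Fin m)) : Equiv.Perm (Fin m → Fin n) :=
  Equiv.arrowCongr e.symm (Equiv.refl _)

theorem preEquiv_apply {m n : ℕ} (e : Equiv.Perm (Fin m)) (I : Fin m → Fin n) :
    preEquiv e I = I ∘ e := by
  ext t; simp [preEquiv]

theorem permMat_mul {m n : ℕ} (B : Matrix (Fin m → Fin n) (Fin m → Fin n) ℝ)
    (σ τ : Equiv.Perm (Fin m)) (π : Equiv.Perm (Fin m ⊕ Fin m)) (I J : Fin m → Fin n) :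
    permMat B (Equiv.sumCongr σ τ * π) I J = permMat B π (I ∘ σ) (J ∘ τ) := by
  have : ∀ y, Sum.elim I J (Equiv.sumCongr σ τ y) = Sum.elim (I ∘ σ) (J ∘ τ) y := by
    rintro (y | y) <;> simp
  simp only [permMat, Matrix.of_apply, Equiv.Perm.mul_apply, this]

theorem permMat_swap {m n : ℕ} (B : Matrix (Fin m → Fin n) (Fin m → Fin n) ℝ)
    (π : Equiv.Perm (Fin m ⊕ Fin m)) (I J : Fin m → Fin n) :
    permMat B (Equiv.sumComm _ _ * π) I J = permMat B π J I := by
  have : ∀ y, Sum.elim I J (Equiv.sumComm _ _ y) = Sum.elim J I y := by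
    rintro (y | y) <;> simp
  simp only [permMat, Matrix.of_apply, Equiv.Perm.mul_apply, this]

theorem sum_permMat_posSemidef {m n : ℕ} (B : Matrix (Fin m → Fin n) (Fin m → Fin n) ℝ)
    (h : ∀ π : Equiv.Perm (Fin m ⊕ Fin m), ∃ e : Equiv.Perm (Fin m), Matrix.PosSemidef
      (Matrix.of fun I J => permMat B π I (J ∘ e))) :
    Matrix.PosSemidef (∑ π : Equiv.Perm (Fin m ⊕ Fin m), permMat B π) := by
  apply Matrix.PosSemidef.of_dotProduct_mulVec_nonneg
  · ext I J
    simp only [Matrix.conjTranspose_apply, star_trivial, Matrix.sum_apply]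
    rw [← Equiv.sum_comp (Equiv.mulLeft (Equiv.sumComm (Fin m) (Fin m)))
      (fun π => permMat B π I J)]
    simp [permMat_swap]
  intro x
  let y : (Fin m → Fin n) → ℝ := fun I => ∑ σ : Equiv.Perm (Fin m), x (I ∘ σ)
  have hy : ∀ (I : Fin m → Fin n) (e : Equiv.Perm (Fin m)), y (I ∘ e) = y I := by
    intro I e
    simp only [y]
    rw [← Equiv.sum_comp (Equiv.mulLeft e) (fun σ => x (I ∘ σ))]
    rfl
  -- each permuted matrix is nonnegative on the symmetrized vector
  have hpos : ∀ π, 0 ≤ ∑ I, ∑ J, y I * permMat B π I J * y J := by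
    intro π
    obtain ⟨e, he⟩ := h π
    have := he.dotProduct_mulVec_nonneg y
    rw [quad_expand] at this
    refine this.trans_eq (Finset.sum_congr rfl fun I _ => ?_)
    rw [← Equiv.sum_comp (preEquiv e) (fun J => y I * permMat B π I J * y J)]
    simp [preEquiv_apply, hy]
  let q : Equiv.Perm (Fin m ⊕ Fin m) → ℝ := fun π => ∑ I, ∑ J, x I * permMat B π I J * x J
  have hq : star x ⬝ᵥ ((∑ π, permMat B π).mulVec x) = ∑ π, q π := by
    rw [Matrix.sum_mulVec, dotProduct_sum]
    simp only [quad_expand, q]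
  rw [hq]
  have hshift : ∀ σ τ : Equiv.Perm (Fin m), ∑ π, q π =
      ∑ π, ∑ I, ∑ J, x (I ∘ σ) * permMat B π I J * x (J ∘ τ) := by
    intro σ τ
    rw [← Equiv.sum_comp (Equiv.mulLeft (Equiv.sumCongr σ⁻¹ τ⁻¹)) q]
    refine Finset.sum_congr rfl fun π _ => ?_
    simp only [q, Equiv.coe_mulLeft, permMat_mul]
    rw [← Equiv.sum_comp (preEquiv σ)]
    refine Finset.sum_congr rfl fun I _ => ?_
    rw [← Equiv.sum_comp (preEquiv τ)]
    refine Finset.sum_congr rfl fun J _ => ?_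
    have hc : ∀ (K : Fin m → Fin n) (ρ : Equiv.Perm (Fin m)), (K ∘ ρ) ∘ ⇑(ρ⁻¹) = K := by
      intro K ρ; ext t; simp
    simp only [preEquiv_apply, hc]
  have htot : ∑ σ : Equiv.Perm (Fin m), ∑ τ : Equiv.Perm (Fin m), ∑ π, q π =
      ∑ π, ∑ I, ∑ J, y I * permMat B π I J * y J := by
    calc _ = ∑ σ : Equiv.Perm (Fin m), ∑ τ : Equiv.Perm (Fin m),
          ∑ π, ∑ I, ∑ J, x (I ∘ σ) * permMat B π I J * x (J ∘ τ) :=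
          Finset.sum_congr rfl fun σ _ => Finset.sum_congr rfl fun τ _ => hshift σ τ
      _ = ∑ σ : Equiv.Perm (Fin m), ∑ π, ∑ τ : Equiv.Perm (Fin m),
          ∑ I, ∑ J, x (I ∘ σ) * permMat B π I J * x (J ∘ τ) :=
          Finset.sum_congr rfl fun σ _ => Finset.sum_comm
      _ = ∑ π, ∑ σ : Equiv.Perm (Fin m), ∑ τ : Equiv.Perm (Fin m),
          ∑ I, ∑ J, x (I ∘ σ) * permMat B π I J * x (J ∘ τ) := Finset.sum_comm
      _ = _ := by
        refine Finset.sum_congr rfl fun π _ => ?_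
        calc _ = ∑ σ : Equiv.Perm (Fin m), ∑ I, ∑ τ : Equiv.Perm (Fin m),
              ∑ J, x (I ∘ σ) * permMat B π I J * x (J ∘ τ) :=
              Finset.sum_congr rfl fun σ _ => Finset.sum_comm
          _ = ∑ I, ∑ σ : Equiv.Perm (Fin m), ∑ τ : Equiv.Perm (Fin m),
              ∑ J, x (I ∘ σ) * permMat B π I J * x (J ∘ τ) := Finset.sum_comm
          _ = _ := by
            refine Finset.sum_congr rfl fun I _ => ?_
            calc _ = ∑ σ : Equiv.Perm (Fin m), ∑ J, ∑ τ : Equiv.Perm (Fin m),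
                  x (I ∘ σ) * permMat B π I J * x (J ∘ τ) :=
                  Finset.sum_congr rfl fun σ _ => Finset.sum_comm
              _ = ∑ J, ∑ σ : Equiv.Perm (Fin m), ∑ τ : Equiv.Perm (Fin m),
                  x (I ∘ σ) * permMat B π I J * x (J ∘ τ) := Finset.sum_comm
              _ = _ := by
                refine Finset.sum_congr rfl fun J _ => ?_
                simp only [y, Finset.sum_mul, Finset.mul_sum]
                rw [Finset.sum_comm]
  have hnn : 0 ≤ ∑ σ : Equiv.Perm (Fin m), ∑ τ : Equiv.Perm (Fin m), ∑ π, q π := by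
    rw [htot]; exact Finset.sum_nonneg fun π _ => hpos π
  simp only [Finset.sum_const, nsmul_eq_mul] at hnn
  have hcard : (0 : ℝ) < ((Finset.univ : Finset (Equiv.Perm (Fin m))).card : ℝ) := by
    exact_mod_cast Finset.card_pos.2 Finset.univ_nonempty
  exact nonneg_of_mul_nonneg_right (nonneg_of_mul_nonneg_right hnn hcard) hcard

theorem stmt18 (n : ℕ) (M : Matrix (Fin n × Fin n) (Fin n × Fin n) ℝ)
    (hsym : ∀ i₁ i₂ i₃ i₄ j₁ j₂ j₃ j₄ : Fin n,
      ({i₁, i₂, i₃, i₄} : Multiset (Fin n)) = {j₁, j₂, j₃, j₄} →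
      M (i₁, i₂) (i₃, i₄) = M (j₁, j₂) (j₃, j₄))
    (hM : M.PosSemidef)
    -- `M_{3,1} ⊗ M_{0,4} ⊗ M_{3,1}` is positive semidefinite (rows and columns
    -- flattened to tuples in `[n]⁶`):
    (hA : Matrix.PosSemidef (Matrix.of fun I J : Fin 6 → Fin n =>
      M (I 0, I 1) (I 2, J 0) * M (J 1, J 2) (J 3, J 4) * M (I 3, I 4) (I 5, J 5)))
    -- `M_{3,1} ⊗ M_{1,3}` is positive semidefinite (rows and columns flattened
    -- to tuples in `[n]⁴`):
    (hB : Matrix.PosSemidef (Matrix.of fun I J : Fin 4 → Fin n =>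
      M (I 0, I 1) (I 2, J 0) * M (I 3, J 1) (J 2, J 3))) :
    ∀ r : ℕ, 0 < r → Matrix.PosSemidef (symMat (kronPow M r)) := by
  intro r _
  exact (sum_permMat_posSemidef _ (permMat_matched n M hsym hM hA hB r)).smul
    (by positivity)
end
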